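/- arXiv:1804.04005 — 6 statements merged into one kernel-verified Lean document; each statement's English description precedes it below -/
import Mathlib

section
/- There exist constants 0 < γ < 1, c > 0, α > 0 and an integer n0 such that for all n ≥ n0 there exists a non-malleable two-source extractor nmExt : {0,1}^n × {0,1}^n → {0,1}^m for min-entropy (1−γ)n with error at most 2^{−c·n·(log log n)/log n} and output length m ≥ α·n. -/
noncomputable section

/-- Bit strings of length `n`. -/
abbrev BS (n : ℕ) : Type := Fin n → Bool

/-- Logarithm base 2. -/
def log2 (x : ℝ) : ℝ := Real.logb 2 x

/-- `p` is a probability distribution on the finite type `α`. -/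
def IsDist {α : Type*} [Fintype α] (p : α → ℝ) : Prop :=
  (∀ a, 0 ≤ p a) ∧ ∑ a, p a = 1

/-- Statistical (total variation) distance between two distributions on a finite type. -/
def sd {α : Type*} [Fintype α] (p q : α → ℝ) : ℝ :=
  (∑ a, |p a - q a|) / 2

/-- Pushforward of a distribution along a function (the distribution of `f(X)` for `X ~ p`). -/
def distMap {α β : Type*} [Fintype α] [DecidableEq β] (f : α → β) (p : α → ℝ) : β → ℝ :=
  fun b => ∑ a, if f a = b then p a else 0

/-- Product (independent joint) distribution. -/
def prodDist {α β : Type*} (p : α → ℝ) (q : β → ℝ) : α × β → ℝ :=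
  fun x => p x.1 * q x.2

/-- Uniform distribution on a finite type. -/
def unifDist (α : Type*) [Fintype α] : α → ℝ :=
  fun _ => 1 / (Fintype.card α : ℝ)

/-- The distribution `p` has min-entropy at least `k` (k real, logs base 2). -/
def minEntropyGe {α : Type*} (p : α → ℝ) (k : ℝ) : Prop :=
  ∀ a, p a ≤ (2 : ℝ) ^ (-k)

/-- `nmExt` is a non-malleable two-source extractor for min-entropy `k` with error `ε`:
for all independent `(n,k)`-sources `X, Y` and tampering functions `f, g`, at least one of
which has no fixed points, `(nmExt(X,Y), nmExt(f(X),g(Y)))` is `ε`-close to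
`(U_m, nmExt(f(X),g(Y)))`. -/
def IsNM2Ext {n m : ℕ} (nmExt : BS n → BS n → BS m) (k ε : ℝ) : Prop :=
  ∀ X Y : BS n → ℝ, IsDist X → IsDist Y → minEntropyGe X k → minEntropyGe Y k →
    ∀ f g : BS n → BS n, ((∀ x, f x ≠ x) ∨ (∀ y, g y ≠ y)) →
      sd (distMap (fun p : BS n × BS n => (nmExt p.1 p.2, nmExt (f p.1) (g p.2)))
            (prodDist X Y))
         (distMap (fun p : BS m × BS n × BS n => (p.1, nmExt (f p.2.1) (g p.2.2)))
            (prodDist (unifDist (BS m)) (prodDist X Y))) ≤ ε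

lemma one_coord {V : Type} [Fintype V] [DecidableEq V] [Nonempty V] (z : V) (t : ℝ) (l : ℝ)
    (ht : |t| ≤ l) (hl : l ≤ 1) :
    ∑ v : V, Real.exp (t * ((if v = z then 1 else 0) - 1 / (Fintype.card V : ℝ))) ≤
      (Fintype.card V : ℝ) * Real.exp (l ^ 2) := by
  have hV : (1 : ℝ) ≤ Fintype.card V := by exact_mod_cast Fintype.card_pos
  have hV0 : (Fintype.card V : ℝ) ≠ 0 := by positivity
  have hi : 1 / (Fintype.card V : ℝ) ≤ 1 := by rw [div_le_one (by linarith)]; exact hV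
  have hi0 : 0 ≤ 1 / (Fintype.card V : ℝ) := by positivity
  have hl0 : 0 ≤ l := le_trans (abs_nonneg t) ht
  have h1 : ∀ v : V, Real.exp (t * ((if v = z then 1 else 0) - 1 / (Fintype.card V : ℝ))) ≤
      (1 + l ^ 2) + t * ((if v = z then 1 else 0) - 1 / (Fintype.card V : ℝ)) := by
    intro v
    set a : ℝ := (if v = z then 1 else 0) - 1 / (Fintype.card V : ℝ) with ha
    have ha1 : |a| ≤ 1 := by
      rw [abs_le, ha]; split_ifs <;> constructor <;> linarith
    have hta : |t * a| ≤ l := by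
      rw [abs_mul]; nlinarith [abs_nonneg t, abs_nonneg a]
    have h2 := Real.abs_exp_sub_one_sub_id_le (x := t * a) (by linarith)
    have h3 : (t * a) ^ 2 ≤ l ^ 2 := by
      rw [← sq_abs]; exact pow_le_pow_left₀ (abs_nonneg _) hta 2
    have := (abs_le.mp h2).2
    linarith
  calc _ ≤ ∑ v : V, ((1 + l ^ 2) + t * ((if v = z then 1 else 0) - 1 / (Fintype.card V : ℝ))) :=
        Finset.sum_le_sum fun v _ => h1 v
    _ = (Fintype.card V : ℝ) * (1 + l ^ 2) := by
        rw [Finset.sum_add_distrib, ← Finset.mul_sum, Finset.sum_sub_distrib]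
        simp [hV0]
        ring
    _ ≤ _ := by
        gcongr
        linarith [Real.add_one_le_exp (l ^ 2)]

lemma mgf {ι V : Type} [Fintype ι] [DecidableEq ι] [Fintype V] [DecidableEq V] [Nonempty V]
    (s : ι → ℝ) (hs : ∀ p, |s p| ≤ 1) (F : ι → ι) (hF : ∀ p, s p ≠ 0 → s (F p) = 0) (z w : V)
    (l : ℝ) (hl0 : 0 ≤ l) (hl : l ≤ 1) :
    ∑ E : ι → V, Real.exp (l * ∑ p, s p * (((if E p = z then 1 else 0) - 1 / (Fintype.card V : ℝ))
      * (if E (F p) = w then 1 else 0))) ≤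
      (Fintype.card V : ℝ) ^ Fintype.card ι * Real.exp (l ^ 2 * Fintype.card ι) := by
  classical
  let P : ι → Prop := fun p => s p ≠ 0
  let e := Equiv.piEquivPiSubtypeProd P (fun _ => V)
  rw [← Equiv.sum_comp e.symm, Fintype.sum_prod_type, Finset.sum_comm]
  have hb : ∀ b : {p // ¬ P p} → V, ∑ a : {p // P p} → V,
      Real.exp (l * ∑ p, s p * (((if e.symm (a, b) p = z then 1 else 0) - 1 / (Fintype.card V : ℝ))
      * (if e.symm (a, b) (F p) = w then 1 else 0))) ≤
      ((Fintype.card V : ℝ) * Real.exp (l ^ 2)) ^ Fintype.card {p // P p} := by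
    intro b
    let t : {p // P p} → ℝ := fun p =>
      l * s p * (if b ⟨F p, fun h => h (hF p p.2)⟩ = w then 1 else 0)
    have hE : ∀ a : {p // P p} → V,
      Real.exp (l * ∑ p, s p * (((if e.symm (a, b) p = z then 1 else 0) - 1 / (Fintype.card V : ℝ))
      * (if e.symm (a, b) (F p) = w then 1 else 0))) =
      ∏ p, Real.exp (t p * ((if a p = z then 1 else 0) - 1 / (Fintype.card V : ℝ))) := by
      intro a
      rw [← Real.exp_sum]
      congr 1
      rw [Finset.mul_sum]
      rw [← Fintype.sum_subtype_add_sum_subtype P]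
      have h0 : ∑ i : {x // ¬ P x}, l * (s ↑i *
          (((if e.symm (a, b) ↑i = z then 1 else 0) - 1 / (Fintype.card V : ℝ))
          * (if e.symm (a, b) (F ↑i) = w then 1 else 0))) = 0 := by
        apply Finset.sum_eq_zero
        intro i _
        have : s i = 0 := not_not.mp i.2
        rw [this]; ring
      rw [h0, add_zero]
      apply Finset.sum_congr rfl
      intro p _
      have e1 : e.symm (a, b) p = a p := by
        simp [e, Equiv.piEquivPiSubtypeProd, p.2]
      have e2 : e.symm (a, b) (F p) = b ⟨F p, fun h => h (hF p p.2)⟩ := by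
        have : ¬ P (F p) := fun h => h (hF p p.2)
        simp [e, Equiv.piEquivPiSubtypeProd, this]
      rw [e1, e2]
      simp only [t]
      ring
    rw [Finset.sum_congr rfl fun a _ => hE a]
    rw [← Fintype.prod_sum (fun (p : {p // P p}) (v : V) =>
      Real.exp (t p * ((if v = z then 1 else 0) - 1 / (Fintype.card V : ℝ))))]
    rw [← Finset.card_univ (α := {p // P p}), ← Finset.prod_const]
    apply Finset.prod_le_prod
    · intro p _; positivity
    · intro p _
      apply one_coord _ _ _ _ hl
      simp only [t]
      rw [abs_mul, abs_mul, abs_of_nonneg hl0]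
      have := hs p
      split_ifs
      · simp; nlinarith
      · simp; exact hl0
  refine (Finset.sum_le_sum fun b _ => hb b).trans ?_
  rw [Finset.sum_const, nsmul_eq_mul, mul_pow, ← Real.exp_nat_mul, ← mul_assoc]
  have hc : Fintype.card ι = Fintype.card {p // ¬ P p} + Fintype.card {p // P p} := by
    rw [Fintype.card_subtype_compl]
    have := Fintype.card_subtype_le P
    omega
  have h1 : ((Finset.univ : Finset ({p // ¬ P p} → V)).card : ℝ) *
      (Fintype.card V : ℝ) ^ Fintype.card {p // P p} = (Fintype.card V : ℝ) ^ Fintype.card ι := by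
    rw [Finset.card_univ, Fintype.card_fun, hc, pow_add]; push_cast; rfl
  rw [h1]
  rw [mul_comm (l ^ 2)]
  gcongr
  exact Fintype.card_subtype_le P

lemma tail {ι V : Type} [Fintype ι] [DecidableEq ι] [Fintype V] [DecidableEq V] [Nonempty V]
    (s : ι → ℝ) (hs : ∀ p, |s p| ≤ 1) (F : ι → ι) (hF : ∀ p, s p ≠ 0 → s (F p) = 0) (z w : V)
    (l : ℝ) (hl0 : 0 ≤ l) (hl : l ≤ 1) (B : Finset (ι → V))
    (hB : ∀ E ∈ B, 2 * l * Fintype.card ι ≤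
      ∑ p, s p * (((if E p = z then 1 else 0) - 1 / (Fintype.card V : ℝ))
      * (if E (F p) = w then 1 else 0))) :
    (B.card : ℝ) ≤ 
      (Fintype.card V : ℝ) ^ Fintype.card ι * Real.exp (- (l ^ 2 * Fintype.card ι)) := by
  have h := mgf s hs F hF z w l hl0 hl
  have h2 : (B.card : ℝ) * Real.exp (l * (2 * l * Fintype.card ι)) ≤ 
      (Fintype.card V : ℝ) ^ Fintype.card ι * Real.exp (l ^ 2 * Fintype.card ι) := by
    refine le_trans ?_ h
    rw [← nsmul_eq_mul, ← Finset.sum_const]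
    refine le_trans ?_ (Finset.sum_le_sum_of_subset_of_nonneg (Finset.subset_univ B) ?_)
    · apply Finset.sum_le_sum
      intro E hE
      have := hB E hE
      gcongr
    · intros; positivity
  have h3 : Real.exp (l * (2 * l * Fintype.card ι)) =
    Real.exp (l ^ 2 * Fintype.card ι) * Real.exp (l ^ 2 * Fintype.card ι) := by
    rw [← Real.exp_add]; ring_nf
  rw [h3, ← mul_assoc] at h2
  have h4 := le_of_mul_le_mul_right h2 (Real.exp_pos _)
  rw [Real.exp_neg, ← div_eq_mul_inv, le_div_iff₀ (Real.exp_pos _)]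
  exact h4

lemma bilin {ι κ : Type} [Fintype ι] [Fintype κ] (M : ι → κ → ℝ) (X : ι → ℝ) (Y : κ → ℝ) (K : ℝ)
    (hX0 : ∀ x, 0 ≤ X x) (hX : ∀ x, X x ≤ K) (hY0 : ∀ x, 0 ≤ Y x) (hY : ∀ x, Y x ≤ K)
    (hK : 0 ≤ K) :
    ∃ (u : ι → SignType) (v : κ → SignType), (∀ x, u x ≠ 0 → ∃ y, M x y ≠ 0) ∧
      (∀ y, v y ≠ 0 → ∃ x, M x y ≠ 0) ∧
      |∑ x, ∑ y, X x * Y y * M x y| ≤ K ^ 2 * ∑ x, ∑ y, ((u x : ℝ) * (v y : ℝ)) * M x y := by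
  let r : ι → ℝ := fun x => ∑ y, Y y * M x y
  let u : ι → SignType := fun x => SignType.sign (r x)
  let q : κ → ℝ := fun y => ∑ x, (u x : ℝ) * M x y
  let v : κ → SignType := fun y => SignType.sign (q y)
  refine ⟨u, v, ?_, ?_, ?_⟩
  · intro x hx
    by_contra! h
    apply hx
    simp [u, r, h]
  · intro x hx
    by_contra! h
    apply hx
    simp [v, q, h]
  · have e1 : ∑ x, ∑ y, X x * Y y * M x y = ∑ x, X x * r x := by
      simp only [r, Finset.mul_sum, mul_assoc]
    have e2 : ∑ x, |r x| = ∑ y, Y y * q y := by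
      simp only [q, Finset.mul_sum]
      rw [Finset.sum_comm]
      apply Finset.sum_congr rfl
      intro x _
      rw [← sign_mul_self (r x)]
      change (u x : ℝ) * r x = _
      simp only [r, Finset.mul_sum]
      apply Finset.sum_congr rfl
      intro y _
      ring
    have e3 : ∑ y, |q y| = ∑ x, ∑ y, ((u x : ℝ) * (v y : ℝ)) * M x y := by
      rw [Finset.sum_comm]
      apply Finset.sum_congr rfl
      intro y _
      rw [← sign_mul_self (q y)]
      change (v y : ℝ) * q y = _
      simp only [q, Finset.mul_sum]
      apply Finset.sum_congr rfl
      intro x _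
      ring
    have b1 : |∑ x, X x * r x| ≤ K * ∑ x, |r x| := by
      rw [Finset.mul_sum]
      refine (Finset.abs_sum_le_sum_abs _ _).trans (Finset.sum_le_sum fun x _ => ?_)
      rw [abs_mul, abs_of_nonneg (hX0 x)]
      exact mul_le_mul_of_nonneg_right (hX x) (abs_nonneg _)
    have b2 : ∑ y, Y y * q y ≤ K * ∑ y, |q y| := by
      rw [Finset.mul_sum]
      refine (Finset.sum_le_sum fun x _ => ?_)
      exact (mul_le_mul_of_nonneg_left (le_abs_self _) (hY0 x)).trans
        (mul_le_mul_of_nonneg_right (hY x) (abs_nonneg _))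
    rw [e1, ← e3, pow_two, mul_assoc]
    refine b1.trans ?_
    rw [e2]
    exact mul_le_mul_of_nonneg_left b2 hK

/-- Discrepancy statement that a random function satisfies. -/
def Good {n m : ℕ} (E : BS n → BS n → BS m) (T : ℝ) : Prop :=
  ∀ (u v : BS n → SignType) (f g : BS n → BS n) (z w : BS m),
    (∀ x y, (u x : ℝ) * (v y : ℝ) ≠ 0 → (u (f x) : ℝ) * (v (g y) : ℝ) = 0) →
    ∑ x, ∑ y, ((u x : ℝ) * (v y : ℝ)) * (((if E x y = z then 1 else 0) - 1 / (2 : ℝ) ^ m)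
      * (if E (f x) (g y) = w then 1 else 0)) ≤ T

lemma abs_sign_le (a : SignType) : |(a : ℝ)| ≤ 1 := by
  cases a <;> simp

lemma exists_good (n m : ℕ) (l : ℝ) (hl0 : 0 ≤ l) (hl : l ≤ 1)
    (hn : ((4 + 2 * n) * 2 ^ n + 2 * m : ℝ) < l ^ 2 * (2 ^ n * 2 ^ n)) :
    ∃ E : BS n → BS n → BS m, Good E (2 * l * (2 ^ n * 2 ^ n)) := by
  classical
  by_contra! hcon
  let I := (BS n → SignType) × (BS n → SignType) × (BS n → BS n) × (BS n → BS n) × BS m × BS m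
  let Q : I → (BS n × BS n → BS m) → Prop := fun i E =>
    (∀ x y, (i.1 x : ℝ) * (i.2.1 y : ℝ) ≠ 0 → (i.1 (i.2.2.1 x) : ℝ) * (i.2.1 (i.2.2.2.1 y) : ℝ) = 0)
    ∧ 2 * l * (2 ^ n * 2 ^ n) ≤ ∑ p : BS n × BS n, ((i.1 p.1 : ℝ) * (i.2.1 p.2 : ℝ)) *
      (((if E p = i.2.2.2.2.1 then 1 else 0) - 1 / (2 : ℝ) ^ m)
      * (if E (i.2.2.1 p.1, i.2.2.2.1 p.2) = i.2.2.2.2.2 then 1 else 0))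
  let bad : I → Finset (BS n × BS n → BS m) := fun i => Finset.univ.filter (Q i)
  have hcι : (Fintype.card (BS n × BS n) : ℝ) = 2 ^ n * 2 ^ n := by simp
  have hcV : (Fintype.card (BS m) : ℝ) = 2 ^ m := by simp
  have hbad : ∀ i, ((bad i).card : ℝ) ≤ (Fintype.card (BS n × BS n → BS m) : ℝ) *
      Real.exp (- (l ^ 2 * (2 ^ n * 2 ^ n))) := by
    rintro ⟨u, v, f, g, z, w⟩
    by_cases hd : ∀ x y, (u x : ℝ) * (v y : ℝ) ≠ 0 → (u (f x) : ℝ) * (v (g y) : ℝ) = 0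
    · have := tail (ι := BS n × BS n) (V := BS m) (fun p => (u p.1 : ℝ) * (v p.2 : ℝ))
        (fun p => by
          rw [abs_mul]
          exact mul_le_one₀ (abs_sign_le _) (abs_nonneg _) (abs_sign_le _))
        (fun p => (f p.1, g p.2)) (fun p hp => hd _ _ hp) z w l hl0 hl (bad (u, v, f, g, z, w))
        (by
          intro E hE
          have := (Finset.mem_filter.mp hE).2.2
          rw [hcι, hcV]
          exact this)
      rw [hcι] at this
      rw [Fintype.card_fun]
      push_cast
      exact this
    · have : bad (u, v, f, g, z, w) = ∅ := by
        apply Finset.filter_eq_empty_iff.mpr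
        intro E _ hQ
        exact hd hQ.1
      rw [this]
      simp only [Finset.card_empty, Nat.cast_zero]
      positivity
  have hcover : (Finset.univ : Finset (BS n × BS n → BS m)) ⊆ Finset.univ.biUnion bad := by
    intro E _
    have h := hcon (fun x y => E (x, y))
    unfold Good at h
    push Not at h
    obtain ⟨u, v, f, g, z, w, hd, hT⟩ := h
    rw [Finset.mem_biUnion]
    refine ⟨(u, v, f, g, z, w), Finset.mem_univ _, Finset.mem_filter.mpr ⟨Finset.mem_univ _, hd, ?_⟩⟩
    rw [Fintype.sum_prod_type]
    exact hT.le
  have h1 : (Fintype.card (BS n × BS n → BS m) : ℝ) ≤ ∑ i, ((bad i).card : ℝ) := by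
    have := (Finset.card_le_card hcover).trans Finset.card_biUnion_le
    rw [Finset.card_univ] at this
    exact_mod_cast this
  have h2 := h1.trans (Finset.sum_le_sum fun i _ => hbad i)
  rw [Finset.sum_const, nsmul_eq_mul, Finset.card_univ] at h2
  have hpos : (0 : ℝ) < Fintype.card (BS n × BS n → BS m) := by
    exact_mod_cast Fintype.card_pos
  have hI : (Fintype.card I : ℝ) ≤ Real.exp ((4 + 2 * n) * 2 ^ n + 2 * m) := by
    have e1 : (Fintype.card I : ℝ) =
      3 ^ (2 ^ n) * (3 ^ (2 ^ n) * ((2 ^ n) ^ (2 ^ n) * ((2 ^ n) ^ (2 ^ n) * (2 ^ m * 2 ^ m)))) := by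
      have : Fintype.card SignType = 3 := rfl
      simp [I, Fintype.card_prod, Fintype.card_fun, this]
    have h3 : (3 : ℝ) ≤ Real.exp 2 := by linarith [Real.add_one_le_exp 2]
    have h2 : (2 : ℝ) ≤ Real.exp 1 := by linarith [Real.add_one_le_exp 1]
    rw [e1]
    calc _ ≤ Real.exp 2 ^ (2 ^ n) * (Real.exp 2 ^ (2 ^ n) * ((Real.exp 1 ^ n) ^ (2 ^ n) *
          ((Real.exp 1 ^ n) ^ (2 ^ n) * (Real.exp 1 ^ m * Real.exp 1 ^ m)))) := by gcongr
      _ = _ := by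
        simp only [← Real.exp_nat_mul, ← Real.exp_add]
        congr 1
        push_cast
        ring
  have h5 : (Fintype.card I : ℝ) * Real.exp (- (l ^ 2 * (2 ^ n * 2 ^ n))) < 1 := by
    rw [Real.exp_neg, ← div_eq_mul_inv, div_lt_one (Real.exp_pos _)]
    exact hI.trans_lt (Real.exp_lt_exp.mpr hn)
  nlinarith

/-- One colour class of a map without fixed points. -/
def colr {n : ℕ} (f : BS n → BS n) (hf : ∀ x, f x ≠ x) (x : BS n) : Fin n × Bool :=
  ((Function.ne_iff.mp (hf x)).choose, x (Function.ne_iff.mp (hf x)).choose)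

lemma colr_ne {n : ℕ} (f : BS n → BS n) (hf : ∀ x, f x ≠ x) (x : BS n) :
    colr f hf (f x) ≠ colr f hf x := by
  intro h
  have h1 := (Function.ne_iff.mp (hf x)).choose_spec
  simp only [colr, Prod.mk.injEq] at h
  apply h1
  rw [← h.2, h.1]

lemma good_bound {n m : ℕ} {E : BS n → BS n → BS m} {T : ℝ} (hE : Good E T)
    (X Y : BS n → ℝ) (K : ℝ) (hX0 : ∀ x, 0 ≤ X x) (hX : ∀ x, X x ≤ K)
    (hY0 : ∀ x, 0 ≤ Y x) (hY : ∀ x, Y x ≤ K) (hK : 0 ≤ K) (f g : BS n → BS n)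
    (hfg : (∀ x, f x ≠ x) ∨ (∀ y, g y ≠ y)) (z w : BS m) :
    |∑ x, ∑ y, X x * Y y * (((if E x y = z then 1 else 0) - 1 / (2 : ℝ) ^ m)
      * (if E (f x) (g y) = w then 1 else 0))| ≤ (2 * n) * (K ^ 2 * T) := by
  classical
  obtain ⟨C, hC, hCF⟩ : ∃ C : BS n → BS n → Fin n × Bool,
      (∀ x y, C (f x) (g y) ≠ C x y) ∧ ((∀ x y y', C x y = C x y') ∨ (∀ x x' y, C x y = C x' y)) := by
    rcases hfg with h | h
    · exact ⟨fun x _ => colr f h x, fun x _ => colr_ne f h x, Or.inl fun _ _ _ => rfl⟩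
    · exact ⟨fun _ y => colr g h y, fun _ y => colr_ne g h y, Or.inr fun _ _ _ => rfl⟩
  set M : BS n → BS n → ℝ := fun x y => (((if E x y = z then 1 else 0) - 1 / (2 : ℝ) ^ m)
      * (if E (f x) (g y) = w then 1 else 0)) with hM
  have hsplit : ∑ x, ∑ y, X x * Y y * M x y =
      ∑ c, ∑ x, ∑ y, X x * Y y * (if C x y = c then M x y else 0) := by
    symm
    rw [Finset.sum_comm]
    apply Finset.sum_congr rfl
    intro x _
    rw [Finset.sum_comm]
    apply Finset.sum_congr rfl
    intro y _
    rw [← Finset.mul_sum]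
    simp
  change |∑ x, ∑ y, X x * Y y * M x y| ≤ _
  rw [hsplit]
  have hc : ∀ c, |∑ x, ∑ y, X x * Y y * (if C x y = c then M x y else 0)| ≤ K ^ 2 * T := by
    intro c
    obtain ⟨u, v, hu, hv, h⟩ := bilin (fun x y => if C x y = c then M x y else 0) X Y K hX0 hX hY0 hY hK
    refine h.trans (mul_le_mul_of_nonneg_left ?_ (by positivity))
    have hsupp : ∀ x y, (u x : ℝ) * (v y : ℝ) ≠ 0 → C x y = c := by
      intro x y hxy
      have hux : u x ≠ 0 := by rintro h0; simp [h0] at hxy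
      have hvy : v y ≠ 0 := by rintro h0; simp [h0] at hxy
      rcases hCF with h1 | h1
      · obtain ⟨y', hy'⟩ := hu x hux
        rw [h1 x y y']
        by_contra h2
        simp [h2] at hy'
      · obtain ⟨x', hx'⟩ := hv y hvy
        rw [h1 x x' y]
        by_contra h2
        simp [h2] at hx'
    refine le_trans (le_of_eq ?_) (hE u v f g z w ?_)
    · apply Finset.sum_congr rfl
      intro x _
      apply Finset.sum_congr rfl
      intro y _
      by_cases hxy : (u x : ℝ) * (v y : ℝ) = 0
      · simp only [hxy, zero_mul]
      · rw [if_pos (hsupp x y hxy)]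
    · intro x y hxy
      by_contra h2
      exact hC x y ((hsupp _ _ h2).trans (hsupp _ _ hxy).symm)
  refine (Finset.abs_sum_le_sum_abs _ _).trans ((Finset.sum_le_sum fun c _ => hc c).trans (le_of_eq ?_))
  rw [Finset.sum_const, nsmul_eq_mul, Finset.card_univ]
  simp only [Fintype.card_prod, Fintype.card_fin, Fintype.card_bool]
  push_cast
  ring

lemma good_nm {n m : ℕ} {E : BS n → BS n → BS m} {T k : ℝ} (hE : Good E T) :
    IsNM2Ext E k (2 ^ m * 2 ^ m * ((2 * n) * (((2 : ℝ) ^ (-k)) ^ 2 * T)) / 2) := by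
  intro X Y hX hY hXk hYk f g hfg
  unfold sd
  gcongr
  have hterm : ∀ a : BS m × BS m, |distMap (fun p : BS n × BS n => (E p.1 p.2, E (f p.1) (g p.2)))
            (prodDist X Y) a - 
         distMap (fun p : BS m × BS n × BS n => (p.1, E (f p.2.1) (g p.2.2)))
            (prodDist (unifDist (BS m)) (prodDist X Y)) a| ≤ 
        (2 * n) * (((2 : ℝ) ^ (-k)) ^ 2 * T) := by
    rintro ⟨z, w⟩
    refine le_trans (le_of_eq ?_) (good_bound hE X Y _ hX.1 hXk hY.1 hYk (by positivity) f g hfg z w)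
    congr 1
    unfold distMap prodDist unifDist
    have e2 : (∑ a : BS m × BS n × BS n, if (a.1, E (f a.2.1) (g a.2.2)) = (z, w) then
        1 / (Fintype.card (BS m) : ℝ) * (X a.2.1 * Y a.2.2) else 0) = 
        ∑ a : BS n × BS n, if E (f a.1) (g a.2) = w then
        1 / (2 : ℝ) ^ m * (X a.1 * Y a.2) else 0 := by
      rw [Fintype.sum_prod_type, Finset.sum_comm]
      apply Finset.sum_congr rfl
      intro a _
      simp [Prod.mk.injEq, ite_and]
    rw [e2, ← Finset.sum_sub_distrib, Fintype.sum_prod_type]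
    apply Finset.sum_congr rfl
    intro x _
    apply Finset.sum_congr rfl
    intro y _
    simp only [Prod.mk.injEq, ite_and]
    split_ifs <;> ring
  refine (Finset.sum_le_sum fun a _ => hterm a).trans (le_of_eq ?_)
  rw [Finset.sum_const, nsmul_eq_mul, Finset.card_univ]
  simp

lemma IsNM2Ext.mono {n m : ℕ} {E : BS n → BS n → BS m} {k e e' : ℝ} (h : IsNM2Ext E k e)
    (he : e ≤ e') : IsNM2Ext E k e' :=
  fun X Y a b c d f g hfg => (h X Y a b c d f g hfg).trans he

lemma aux_pow (r : ℕ) (hr : 4 ≤ r) : 16 * (r + 1) < 4 ^ r := by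
  induction r, hr using Nat.le_induction with
  | base => norm_num
  | succ r hr ih => rw [pow_succ]; omega

lemma eventually_small : ∃ n1 : ℕ, ∀ n : ℕ, n1 ≤ n → (n : ℝ) * 16 ≤ (2 : ℝ) ^ ((n : ℝ) / 16) := by
  have h := tendsto_pow_const_mul_const_pow_of_abs_lt_one 1
    (r := (2 : ℝ) ^ (-(1 / 16) : ℝ)) (by
      rw [abs_of_pos (by positivity)]
      exact Real.rpow_lt_one_of_one_lt_of_neg (by norm_num) (by norm_num))
  have h2 := h.eventually (gt_mem_nhds (show (0 : ℝ) < 1 / 16 by norm_num))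
  obtain ⟨n1, h1⟩ := Filter.eventually_atTop.mp h2
  refine ⟨n1, fun n hn => ?_⟩
  have h3 := h1 n hn
  have e : (2 : ℝ) ^ ((n : ℝ) / 16) * ((2 : ℝ) ^ (-(1 / 16) : ℝ)) ^ n = 1 := by
    rw [← Real.rpow_natCast, ← Real.rpow_mul (by norm_num), ← Real.rpow_add (by norm_num)]
    ring_nf
    simp
  have hp : 0 < (2 : ℝ) ^ ((n : ℝ) / 16) := by positivity
  rw [pow_one] at h3
  have h4 := mul_lt_mul_of_pos_left h3 hp
  have h5 : (2 : ℝ) ^ ((n : ℝ) / 16) * (n * ((2 : ℝ) ^ (-(1 / 16) : ℝ)) ^ n) = n := by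
    rw [mul_left_comm, e, mul_one]
  linarith

theorem stmt2 :
    ∃ (γ c α : ℝ) (n0 : ℕ), 0 < γ ∧ γ < 1 ∧ 0 < c ∧ 0 < α ∧
      ∀ n : ℕ, n0 ≤ n →
        ∃ (m : ℕ) (nmExt : BS n → BS n → BS m),
          α * n ≤ (m : ℝ) ∧
          IsNM2Ext nmExt ((1 - γ) * n)
            ((2 : ℝ) ^ (-(c * n * log2 (log2 n) / log2 n))) := by
  obtain ⟨n1, hn1⟩ := eventually_small
  refine ⟨1 / 32, 1 / 16, 1 / 32, max 64 n1, by norm_num, by norm_num, by norm_num, by norm_num, ?_⟩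
  intro n hn
  have hn64 : 64 ≤ n := (le_max_left _ _).trans hn
  have hsm := hn1 n ((le_max_right _ _).trans hn)
  set r := n / 4 with hr
  set m := n / 32 + 1 with hm
  have hnr : (n : ℝ) ≤ 4 * r + 3 := by
    have : n ≤ 4 * r + 3 := by omega
    exact_mod_cast this
  have hmn : (m : ℝ) ≤ n / 32 + 1 := by
    have : 32 * m ≤ n + 32 := by omega
    have : (32 * m : ℝ) ≤ n + 32 := by exact_mod_cast this
    linarith
  have hmn2 : (n : ℝ) / 32 ≤ m := by
    have : n ≤ 32 * m := by omega
    have : (n : ℝ) ≤ 32 * m := by exact_mod_cast this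
    linarith
  have hl1 : ((1 : ℝ) / 2 ^ r) ≤ 1 := by
    rw [div_le_one (by positivity)]
    exact one_le_pow₀ (by norm_num)
  obtain ⟨E, hE⟩ := exists_good n m (1 / 2 ^ r) (by positivity) hl1 (by
    have h1 := aux_pow r (by omega)
    have h2 : ((1 : ℝ) / 2 ^ r) ^ 2 * (2 ^ n * 2 ^ n) = 2 ^ n * 2 ^ (n - 2 * r) := by
      have : (2 : ℝ) ^ n = 2 ^ (n - 2 * r) * (2 ^ r) ^ 2 := by
        rw [← pow_mul, ← pow_add]; congr 1; omega
      field_simp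
      rw [this]
      ring
    rw [h2]
    have h3 : 4 ^ r ≤ 2 ^ (n - 2 * r) := by
      rw [show 4 = 2 ^ 2 by norm_num, ← pow_mul]
      exact Nat.pow_le_pow_right (by norm_num) (by omega)
    have h4 : (4 + 2 * n) * 2 ^ n + 2 * m < 2 ^ n * 2 ^ (n - 2 * r) := by
      have h5 : 4 + 2 * n + 2 * m < 2 ^ (n - 2 * r) := by omega
      have h6 : 1 ≤ 2 ^ n := Nat.one_le_two_pow
      nlinarith
    exact_mod_cast h4)
  refine ⟨m, E, by linarith, (good_nm hE).mono ?_⟩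
  have hn' : (64 : ℝ) ≤ n := by exact_mod_cast hn64
  have hlog : (n : ℝ) / 16 * (log2 (log2 n) / log2 n) ≤ n / 16 := by
    have hL : 0 < log2 n := Real.logb_pos (by norm_num) (by linarith)
    have h1 : log2 (log2 n) ≤ log2 n := by
      unfold log2 at *
      apply Real.logb_le_logb_of_le (by norm_num) hL
      rw [Real.logb_le_iff_le_rpow (by norm_num) (by linarith), Real.rpow_natCast]
      exact_mod_cast n.lt_two_pow_self.le
    have : log2 (log2 n) / log2 n ≤ 1 := by rw [div_le_one hL]; exact h1
    have h0 : (0 : ℝ) ≤ n / 16 := by positivity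
    nlinarith
  have hfin : (2 : ℝ) ^ (-((n : ℝ) / 16)) ≤ (2 : ℝ) ^ (-(1 / 16 * n * log2 (log2 n) / log2 n)) := by
    apply Real.rpow_le_rpow_of_exponent_le (by norm_num)
    have : 1 / 16 * n * log2 (log2 n) / log2 n = (n : ℝ) / 16 * (log2 (log2 n) / log2 n) := by ring
    rw [this]
    linarith
  refine le_trans ?_ hfin
  have e1 : (2 : ℝ) ^ m * 2 ^ m * (2 * n * (((2 : ℝ) ^ (-((1 - 1 / 32) * (n : ℝ)))) ^ 2 *
      (2 * (1 / 2 ^ r) * (2 ^ n * 2 ^ n)))) / 2 =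
      n * 2 * (2 : ℝ) ^ (2 * (m : ℝ) + n / 16 - r) := by
    have : (2 : ℝ) ^ (2 * (m : ℝ) + n / 16 - r) = 2 ^ m * 2 ^ m *
       ((2 : ℝ) ^ (-((1 - 1 / 32) * (n : ℝ)))) ^ 2 * (2 ^ n * 2 ^ n) / 2 ^ r := by
      simp only [← Real.rpow_natCast]
      rw [← Real.rpow_mul (by norm_num), ← Real.rpow_add (by norm_num), ← Real.rpow_add (by norm_num),
        ← Real.rpow_add (by norm_num), ← Real.rpow_add (by norm_num), ← Real.rpow_sub (by norm_num)]
      congr 1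
      push_cast
      ring
    rw [this]
    ring
  rw [e1]
  have h7 : (2 : ℝ) ^ (2 * (m : ℝ) + n / 16 - r) ≤ 2 ^ (3 - (n : ℝ) / 8) := by
    apply Real.rpow_le_rpow_of_exponent_le (by norm_num)
    linarith
  have h8 : (2 : ℝ) ^ (3 - (n : ℝ) / 8) = 8 * ((2 : ℝ) ^ (-((n : ℝ) / 16)) * (2 : ℝ) ^ (-((n : ℝ) / 16))) := by
    rw [← Real.rpow_add (by norm_num), show (8 : ℝ) = 2 ^ (3 : ℝ) by norm_num,
      ← Real.rpow_add (by norm_num)]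
    ring_nf
  have h9 : (2 : ℝ) ^ ((n : ℝ) / 16) * (2 : ℝ) ^ (-((n : ℝ) / 16)) = 1 := by
    rw [← Real.rpow_add (by norm_num)]; simp
  have hp : 0 < (2 : ℝ) ^ (-((n : ℝ) / 16)) := by positivity
  calc (n : ℝ) * 2 * (2 : ℝ) ^ (2 * (m : ℝ) + n / 16 - r)
      ≤ n * 2 * (8 * ((2 : ℝ) ^ (-((n : ℝ) / 16)) * (2 : ℝ) ^ (-((n : ℝ) / 16)))) := by
        rw [← h8]; gcongr
    _ = (n * 16) * (2 : ℝ) ^ (-((n : ℝ) / 16)) * (2 : ℝ) ^ (-((n : ℝ) / 16)) := by ring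
    _ ≤ (2 : ℝ) ^ ((n : ℝ) / 16) * (2 : ℝ) ^ (-((n : ℝ) / 16)) * (2 : ℝ) ^ (-((n : ℝ) / 16)) := by
        gcongr
    _ = _ := by rw [h9, one_mul]
end
end

section
/- For every ε > 0 there exist a constant C > 1 and an integer n0 such that for every n ≥ n0 and every k with k ≥ C·(log n · log log n)/log log log n, there exists a two-source extractor Ext : {0,1}^n × {0,1}^n → {0,1} for min-entropy k with error ε. -/
noncomputable section

/-- `ext` is a two-source extractor for min-entropy `k` with error `ε`: for all independent
`(n,k)`-sources `X, Y`, `ext(X,Y)` is `ε`-close to uniform. -/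
def Is2SourceExt {n m : ℕ} (ext : BS n → BS n → BS m) (k ε : ℝ) : Prop :=
  ∀ X Y : BS n → ℝ, IsDist X → IsDist Y → minEntropyGe X k → minEntropyGe Y k →
    sd (distMap (fun p : BS n × BS n => ext p.1 p.2) (prodDist X Y))
       (unifDist (BS m)) ≤ ε

open Finset in
theorem aux_hoeff {α : Type*} [Fintype α] [DecidableEq α] (P : Finset α) (t : ℝ) :
    ∑ f : α → Bool, Real.exp (t * ∑ p ∈ P, (if f p then (1 : ℝ) else -1))
      ≤ 2 ^ Fintype.card α * Real.exp (t ^ 2 * (P.card : ℝ) / 2) := by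
  have h1 : ∀ f : α → Bool, Real.exp (t * ∑ p ∈ P, (if f p then (1 : ℝ) else -1))
      = ∏ p, (fun (p : α) (b : Bool) =>
        if p ∈ P then Real.exp (t * (if b then (1 : ℝ) else -1)) else 1) p (f p) := by
    intro f
    rw [Finset.mul_sum, Real.exp_sum]
    simp [Finset.prod_ite_mem]
  simp_rw [h1]
  rw [← Fintype.prod_sum (fun (p : α) (b : Bool) =>
        if p ∈ P then Real.exp (t * (if b then (1 : ℝ) else -1)) else 1)]
  have h2 : ∀ p : α, (∑ b : Bool,
      if p ∈ P then Real.exp (t * (if b then (1 : ℝ) else -1)) else 1)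
      ≤ 2 * (if p ∈ P then Real.exp (t ^ 2 / 2) else 1) := by
    intro p
    by_cases hp : p ∈ P
    · simp only [hp, if_true, Fintype.sum_bool]
      have := Real.cosh_le_exp_half_sq t
      rw [Real.cosh_eq] at this
      simp
      linarith
    · simp [hp]
  refine (Finset.prod_le_prod ?_ (fun p _ => h2 p)).trans ?_
  · intro p _
    apply Finset.sum_nonneg
    intro b _
    split_ifs <;> positivity
  · rw [Finset.prod_mul_distrib]
    apply le_of_eq
    rw [Finset.prod_const, Finset.card_univ, Finset.prod_ite_mem, Finset.univ_inter,
      Finset.prod_const, ← Real.exp_nat_mul]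
    congr 2
    ring

theorem aux_exists {α : Type*} [Fintype α] [DecidableEq α] (K : ℕ) (t : ℝ)
    (h : 2 * ((Fintype.card α : ℝ) ^ K) ^ 2 * Real.exp (t ^ 2 * (K : ℝ) ^ 2 / 2)
      < Real.exp (t ^ 2 * (K : ℝ) ^ 2)) (ht : 0 < t) :
    ∃ f : α × α → Bool, ∀ S T : Finset α, S.card = K → T.card = K →
      |∑ p ∈ S ×ˢ T, (if f p then (1 : ℝ) else -1)| < t * (K : ℝ) ^ 2 := by
  by_contra hc
  push Not at hc
  set I := (Finset.univ : Finset α).powersetCard K ×ˢ (Finset.univ : Finset α).powersetCard K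
    with hI
  set F : (α × α → Bool) → Finset α × Finset α → ℝ :=
    fun f q => ∑ p ∈ q.1 ×ˢ q.2, (if f p then (1 : ℝ) else -1) with hF
  have lower : ∀ f : α × α → Bool, Real.exp (t ^ 2 * (K : ℝ) ^ 2) ≤
      ∑ q ∈ I, (Real.exp (t * F f q) + Real.exp ((-t) * F f q)) := by
    intro f
    obtain ⟨S, T, hS, hT, hb⟩ := hc f
    have hm : (S, T) ∈ I := by
      simp [hI, Finset.mem_powersetCard, hS, hT]
    refine le_trans ?_ (Finset.single_le_sum
      (f := fun q => Real.exp (t * F f q) + Real.exp ((-t) * F f q)) ?_ hm)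
    · rcases le_abs.1 hb with hb | hb
      · have : Real.exp (t ^ 2 * (K : ℝ) ^ 2) ≤ Real.exp (t * F f (S, T)) := by
          apply Real.exp_le_exp.2
          have := mul_le_mul_of_nonneg_left hb ht.le
          simp only [hF]
          linarith
        have := Real.exp_pos ((-t) * F f (S, T))
        linarith
      · have : Real.exp (t ^ 2 * (K : ℝ) ^ 2) ≤ Real.exp ((-t) * F f (S, T)) := by
          apply Real.exp_le_exp.2
          have := mul_le_mul_of_nonneg_left hb ht.le
          simp only [hF]
          linarith
        have := Real.exp_pos (t * F f (S, T))
        linarith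
    · intro q _
      positivity
  have hsum := Finset.sum_le_sum (fun f (_ : f ∈ (Finset.univ : Finset (α × α → Bool))) => lower f)
  rw [Finset.sum_comm] at hsum
  have upper : ∀ q ∈ I, ∑ f : α × α → Bool,
      (Real.exp (t * F f q) + Real.exp ((-t) * F f q)) ≤
      2 * (2 ^ Fintype.card (α × α) * Real.exp (t ^ 2 * (K : ℝ) ^ 2 / 2)) := by
    intro q hq
    rw [Finset.sum_add_distrib]
    have e1 := aux_hoeff (q.1 ×ˢ q.2) t
    have e2 := aux_hoeff (q.1 ×ˢ q.2) (-t)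
    simp only [hI, Finset.mem_product, Finset.mem_powersetCard] at hq
    have hcard : (((q.1 ×ˢ q.2).card : ℕ) : ℝ) = (K : ℝ) ^ 2 := by
      rw [Finset.card_product, hq.1.2, hq.2.2]; push_cast; ring
    rw [hcard] at e1 e2
    rw [neg_sq] at e2
    simp only [hF]
    linarith
  have hsum2 := hsum.trans (Finset.sum_le_sum upper)
  rw [Finset.sum_const, Finset.sum_const, nsmul_eq_mul, nsmul_eq_mul] at hsum2
  have hIc : (I.card : ℝ) ≤ ((Fintype.card α : ℝ) ^ K) ^ 2 := by
    rw [hI, Finset.card_product, Finset.card_powersetCard, Finset.card_univ]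
    have : (((Fintype.card α).choose K : ℕ) : ℝ) ≤ (Fintype.card α : ℝ) ^ K := by
      exact_mod_cast Nat.choose_le_pow _ _
    push_cast
    rw [sq]
    gcongr
  have hU : (((Finset.univ : Finset (α × α → Bool)).card : ℕ) : ℝ) = 2 ^ Fintype.card (α × α) := by
    simp
  rw [hU] at hsum2
  have hpos : (0 : ℝ) < 2 ^ Fintype.card (α × α) := by positivity
  have h3 : (I.card : ℝ) * (2 * (2 ^ Fintype.card (α × α) * Real.exp (t ^ 2 * (K : ℝ) ^ 2 / 2)))
      ≤ ((Fintype.card α : ℝ) ^ K) ^ 2 *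
        (2 * (2 ^ Fintype.card (α × α) * Real.exp (t ^ 2 * (K : ℝ) ^ 2 / 2))) := by
    gcongr
  have h4 := mul_lt_mul_of_pos_left h hpos
  linarith

theorem aux_thresh {α : Type*} [Fintype α] (X g : α → ℝ) (hX : IsDist X) (μ a : ℝ)
    (hμ : ∀ x, X x ≤ μ) (ha : 0 ≤ a) (hg : ∀ x, g x ≤ 1) (h : 2 * a < ∑ x, X x * g x) :
    a < μ * ((Finset.univ.filter (fun x => a < g x)).card : ℝ) := by
  have h1 : ∀ x, X x * g x ≤ a * X x + (if a < g x then μ else 0) := by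
    intro x
    have h0 := hX.1 x
    have := hμ x
    have := hg x
    split_ifs with hx
    · nlinarith
    · nlinarith
  have h2 := Finset.sum_le_sum (fun x (_ : x ∈ (Finset.univ : Finset α)) => h1 x)
  rw [Finset.sum_add_distrib, ← Finset.mul_sum, hX.2, ← Finset.sum_filter, Finset.sum_const,
    nsmul_eq_mul] at h2
  linarith

theorem aux_bilin {α : Type*} [Fintype α] [DecidableEq α] (s : α × α → ℝ) (hs : ∀ p, s p ≤ 1)
    (K : ℕ) (hK : 0 < K) (ε μ : ℝ) (hε : 0 < ε) (hμ0 : 0 < μ) (hKμ : μ * K ≤ ε / 2)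
    (hgood : ∀ S T : Finset α, S.card = K → T.card = K →
      ∑ p ∈ S ×ˢ T, s p < ε / 2 * (K : ℝ) ^ 2)
    (X Y : α → ℝ) (hX : IsDist X) (hY : IsDist Y) (hXμ : ∀ x, X x ≤ μ) (hYμ : ∀ x, Y x ≤ μ) :
    ∑ x, X x * ∑ y, Y y * s (x, y) ≤ 2 * ε := by
  by_contra hc
  push Not at hc
  have hKr : (0 : ℝ) < K := by exact_mod_cast hK
  have b1 := aux_thresh X (fun x => ∑ y, Y y * s (x, y)) hX μ ε hXμ hε.le (by
    intro x
    rw [← hY.2]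
    apply Finset.sum_le_sum
    intro y _
    have := hY.1 y
    have := hs (x, y)
    nlinarith) hc
  have c1 : K ≤ (Finset.univ.filter (fun x => ε < ∑ y, Y y * s (x, y))).card := by
    have : μ * (K : ℝ) ≤ μ * ((Finset.univ.filter (fun x => ε < ∑ y, Y y * s (x, y))).card : ℝ) := by
      linarith
    exact_mod_cast le_of_mul_le_mul_left this hμ0
  obtain ⟨S, hS, hSc⟩ := Finset.exists_subset_card_eq c1
  have d1 : ε * K < ∑ x ∈ S, ∑ y, Y y * s (x, y) := by
    have : ∑ x ∈ S, ε < ∑ x ∈ S, ∑ y, Y y * s (x, y) := by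
      apply Finset.sum_lt_sum_of_nonempty
      · rw [← Finset.card_pos]; omega
      · intro x hx
        exact (Finset.mem_filter.1 (hS hx)).2
    rw [Finset.sum_const, nsmul_eq_mul, hSc] at this
    linarith
  have d2 : 2 * (ε / 2) < ∑ y, Y y * ((∑ x ∈ S, s (x, y)) / K) := by
    have : ∑ y, Y y * ((∑ x ∈ S, s (x, y)) / K) = (∑ x ∈ S, ∑ y, Y y * s (x, y)) / K := by
      rw [Finset.sum_comm, Finset.sum_div]
      apply Finset.sum_congr rfl
      intro y _
      rw [← Finset.mul_sum, mul_div_assoc]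
    rw [this, lt_div_iff₀ hKr]
    linarith
  have b2 := aux_thresh Y (fun y => (∑ x ∈ S, s (x, y)) / K) hY μ (ε / 2) hYμ (by positivity) (by
    intro y
    rw [div_le_one hKr]
    have := Finset.sum_le_sum (fun x (_ : x ∈ S) => hs (x, y))
    rw [Finset.sum_const, hSc] at this
    simpa using this) d2
  have c2 : K ≤ (Finset.univ.filter (fun y => ε / 2 < (∑ x ∈ S, s (x, y)) / K)).card := by
    have : μ * (K : ℝ) ≤
        μ * ((Finset.univ.filter (fun y => ε / 2 < (∑ x ∈ S, s (x, y)) / K)).card : ℝ) := by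
      linarith
    exact_mod_cast le_of_mul_le_mul_left this hμ0
  obtain ⟨T, hT, hTc⟩ := Finset.exists_subset_card_eq c2
  have e1 : (K : ℝ) * (ε / 2 * K) ≤ ∑ y ∈ T, ∑ x ∈ S, s (x, y) := by
    have : ∑ y ∈ T, (ε / 2 * K) ≤ ∑ y ∈ T, ∑ x ∈ S, s (x, y) := by
      apply Finset.sum_le_sum
      intro y hy
      have := (Finset.mem_filter.1 (hT hy)).2
      rw [lt_div_iff₀ hKr] at this
      exact this.le
    rw [Finset.sum_const, nsmul_eq_mul, hTc] at this
    exact this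
  have := hgood S T hSc hTc
  rw [Finset.sum_product_right] at this
  nlinarith

theorem aux_ext {n : ℕ} (f : BS n × BS n → Bool) (X Y : BS n → ℝ) (hX : IsDist X) (hY : IsDist Y)
    (ε : ℝ) (h : |∑ x, X x * ∑ y, Y y * (if f (x, y) then (1 : ℝ) else -1)| ≤ 2 * ε) :
    sd (distMap (fun p : BS n × BS n => (fun _ => f p : BS 1)) (prodDist X Y))
       (unifDist (BS 1)) ≤ ε := by
  set D := distMap (fun p : BS n × BS n => (fun _ => f p : BS 1)) (prodDist X Y) with hD
  have hs : ∀ F : BS 1 → ℝ, ∑ a, F a = F (fun _ => true) + F (fun _ => false) := by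
    intro F
    rw [← (Equiv.funUnique (Fin 1) Bool).symm.sum_comp]
    simp only [Fintype.sum_bool]
    rfl
  have hneq : (fun _ : Fin 1 => true) ≠ (fun _ : Fin 1 => false) := by
    intro h; simpa using congrFun h 0
  have hT : D (fun _ => true) = ∑ p : BS n × BS n, if f p then X p.1 * Y p.2 else 0 := by
    simp only [hD, distMap, prodDist]
    apply Finset.sum_congr rfl
    intro p _
    cases hp : f p <;> simp [hneq.symm]
  have hFa : D (fun _ => false) = ∑ p : BS n × BS n, if f p then 0 else X p.1 * Y p.2 := by
    simp only [hD, distMap, prodDist]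
    apply Finset.sum_congr rfl
    intro p _
    cases hp : f p <;> simp [hneq]
  have h1 : D (fun _ => true) + D (fun _ => false) = 1 := by
    rw [hT, hFa, ← Finset.sum_add_distrib]
    have : ∀ p : BS n × BS n, ((if f p then X p.1 * Y p.2 else 0) +
      if f p then 0 else X p.1 * Y p.2) = X p.1 * Y p.2 := by
      intro p; split_ifs <;> simp
    simp_rw [this]
    rw [Fintype.sum_prod_type]
    simp only
    simp_rw [← Finset.mul_sum]
    rw [hY.2]; simp [hX.2]
  have h2 : D (fun _ => true) - D (fun _ => false) =
      ∑ x, X x * ∑ y, Y y * (if f (x, y) then (1 : ℝ) else -1) := by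
    rw [hT, hFa, ← Finset.sum_sub_distrib, Fintype.sum_prod_type]
    apply Finset.sum_congr rfl
    intro x _
    rw [Finset.mul_sum]
    apply Finset.sum_congr rfl
    intro y _
    split_ifs <;> simp
  rw [← h2, abs_le] at h
  have hu : ∀ a, unifDist (BS 1) a = 1 / 2 := by
    intro a; simp [unifDist]
  unfold sd
  rw [hs, hu, hu]
  have a1 : |D (fun _ => true) - 1 / 2| ≤ ε := by rw [abs_le]; constructor <;> linarith
  have a2 : |D (fun _ => false) - 1 / 2| ≤ ε := by rw [abs_le]; constructor <;> linarith
  linarith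

theorem aux_k (n k : ℕ) (hn : 16 ≤ n)
    (h : 2 * (log2 n * log2 (log2 n) / log2 (log2 (log2 n))) ≤ (k : ℝ)) :
    (n : ℝ) ^ 2 ≤ 2 ^ k := by
  have mono : ∀ (x : ℝ) (m : ℕ), (2 : ℝ) ^ m ≤ x → (m : ℝ) ≤ log2 x := by
    intro x m hx
    unfold log2
    rw [Real.le_logb_iff_rpow_le (by norm_num) (lt_of_lt_of_le (by positivity) hx),
      Real.rpow_natCast]
    exact hx
  have hn' : (16 : ℝ) ≤ n := by exact_mod_cast hn
  have l1 : (4 : ℝ) ≤ log2 n := by simpa using mono n 4 (by norm_num; exact_mod_cast hn)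
  have l2 : (2 : ℝ) ≤ log2 (log2 n) := by simpa using mono (log2 n) 2 (by norm_num; exact l1)
  have l3 : (1 : ℝ) ≤ log2 (log2 (log2 n)) := by
    simpa using mono (log2 (log2 n)) 1 (by norm_num; exact l2)
  have l4 : log2 (log2 (log2 n)) ≤ log2 (log2 n) := by
    generalize log2 (log2 (n : ℝ)) = y at l2
    unfold log2
    rw [Real.logb, div_le_iff₀ (Real.log_pos (by norm_num))]
    have e : Real.log y = Real.log 2 + Real.log (y / 2) := by
      rw [Real.log_div (by linarith) (by norm_num)]; ring
    have := Real.log_le_sub_one_of_pos (show 0 < y / 2 by linarith)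
    have := Real.log_two_gt_d9
    nlinarith
  have l5 : log2 n ≤ log2 n * log2 (log2 n) / log2 (log2 (log2 n)) := by
    rw [le_div_iff₀ (by linarith)]
    gcongr
  have l6 : 2 * log2 n ≤ k := by linarith
  have l7 : (2 : ℝ) ^ (2 * log2 n) ≤ (2 : ℝ) ^ (k : ℝ) :=
    Real.rpow_le_rpow_of_exponent_le (by norm_num) l6
  rw [Real.rpow_natCast, mul_comm, Real.rpow_mul (by norm_num), log2,
    Real.rpow_logb (by norm_num) (by norm_num) (by linarith)] at l7
  exact_mod_cast l7

theorem stmt4 :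
    ∀ ε : ℝ, 0 < ε →
      ∃ (C : ℝ) (n0 : ℕ), 1 < C ∧
        ∀ n : ℕ, n0 ≤ n → ∀ k : ℕ,
          C * (log2 n * log2 (log2 n) / log2 (log2 (log2 n))) ≤ (k : ℝ) →
          ∃ ext : BS n → BS n → BS 1, Is2SourceExt ext (k : ℝ) ε := by
  intro ε hε
  obtain ⟨n1, hn1⟩ := exists_nat_ge (2 / ε * (24 / ε ^ 2 + 1))
  refine ⟨2, max 16 n1, by norm_num, ?_⟩
  intro n hn k hk
  have hn16 : 16 ≤ n := (le_max_left _ _).trans hn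
  have hnn1 : (n1 : ℝ) ≤ n := by exact_mod_cast (le_max_right _ _).trans hn
  have hn' : (16 : ℝ) ≤ n := by exact_mod_cast hn16
  have hk2 := aux_k n k hn16 hk
  set K : ℕ := ⌊ε / 2 * 2 ^ k⌋₊ with hKdef
  have hKle : (K : ℝ) ≤ ε / 2 * 2 ^ k := Nat.floor_le (by positivity)
  have hKlt : ε / 2 * 2 ^ k < K + 1 := Nat.lt_floor_add_one _
  have hbig : 24 / ε ^ 2 * n ≤ K := by
    have h1 : 2 / ε * (24 / ε ^ 2 + 1) ≤ n := hn1.trans hnn1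
    have h2 : 24 / ε ^ 2 + 1 ≤ ε / 2 * n := by
      have := mul_le_mul_of_nonneg_left h1 (show 0 ≤ ε / 2 by positivity)
      calc 24 / ε ^ 2 + 1 = ε / 2 * (2 / ε * (24 / ε ^ 2 + 1)) := by field_simp
        _ ≤ _ := this
    have h3 := mul_le_mul_of_nonneg_right h2 (show (0 : ℝ) ≤ n by linarith)
    have h4 := mul_le_mul_of_nonneg_left hk2 (show 0 ≤ ε / 2 by positivity)
    linarith
  have hKpos : (0 : ℝ) < K := lt_of_lt_of_le (by positivity) hbig
  have hKpos' : 0 < K := by exact_mod_cast hKpos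
  have hK1 : (1 : ℝ) ≤ K := by exact_mod_cast hKpos'
  have hnum : 2 * ((Fintype.card (BS n) : ℝ) ^ K) ^ 2 * Real.exp ((ε / 2) ^ 2 * (K : ℝ) ^ 2 / 2)
      < Real.exp ((ε / 2) ^ 2 * (K : ℝ) ^ 2) := by
    have hc : (2 : ℝ) * ((Fintype.card (BS n) : ℝ) ^ K) ^ 2 = 2 ^ (2 * (K * n) + 1) := by
      simp only [Fintype.card_pi, Fintype.card_bool, Finset.prod_const, Finset.card_univ,
        Fintype.card_fin]
      push_cast
      rw [← pow_mul, ← pow_mul]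
      ring
    have h2e : (2 : ℝ) < Real.exp 1 := by have := Real.exp_one_gt_d9; linarith
    have hlt : (2 : ℝ) ^ (2 * (K * n) + 1) < Real.exp ((ε / 2) ^ 2 * (K : ℝ) ^ 2 / 2) := by
      calc (2 : ℝ) ^ (2 * (K * n) + 1) < (Real.exp 1) ^ (2 * (K * n) + 1) :=
            pow_lt_pow_left₀ h2e (by norm_num) (by omega)
        _ = Real.exp ((2 * (K * n) + 1 : ℕ) : ℝ) := by rw [← Real.exp_nat_mul, mul_one]
        _ ≤ _ := by
          apply Real.exp_le_exp.2
          push_cast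
          have h24 : 24 * (n : ℝ) ≤ ε ^ 2 * K := by
            have := mul_le_mul_of_nonneg_left hbig (show 0 ≤ ε ^ 2 by positivity)
            calc 24 * (n : ℝ) = ε ^ 2 * (24 / ε ^ 2 * n) := by field_simp
              _ ≤ _ := this
          have := mul_le_mul_of_nonneg_right h24 hKpos.le
          nlinarith
    rw [hc]
    calc _ < Real.exp ((ε / 2) ^ 2 * (K : ℝ) ^ 2 / 2) * Real.exp ((ε / 2) ^ 2 * (K : ℝ) ^ 2 / 2) :=
          mul_lt_mul_of_pos_right hlt (Real.exp_pos _)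
      _ = _ := by rw [← Real.exp_add]; congr 1; ring
  obtain ⟨f, hf⟩ := aux_exists (α := BS n) K (ε / 2) hnum (by positivity)
  refine ⟨fun x y _ => f (x, y), ?_⟩
  intro X Y hX hY hXk hYk
  have hμ : (2 : ℝ) ^ (-(k : ℝ)) * K ≤ ε / 2 := by
    rw [Real.rpow_neg (by norm_num), Real.rpow_natCast, inv_mul_le_iff₀ (by positivity)]
    linarith
  have hμ0 : (0 : ℝ) < (2 : ℝ) ^ (-(k : ℝ)) := by positivity
  apply aux_ext f X Y hX hY
  have u := aux_bilin (fun p => if f p then (1 : ℝ) else -1)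
    (by intro p; split_ifs <;> norm_num) K hKpos' ε _ hε hμ0 hμ
    (fun S T hS hT => (abs_lt.1 (hf S T hS hT)).2) X Y hX hY hXk hYk
  have v := aux_bilin (fun p => -(if f p then (1 : ℝ) else -1))
    (by intro p; split_ifs <;> norm_num) K hKpos' ε _ hε hμ0 hμ
    (fun S T hS hT => by
      have := (abs_lt.1 (hf S T hS hT)).1
      rw [Finset.sum_neg_distrib]
      linarith) X Y hX hY hXk hYk
  simp only [mul_neg, Finset.sum_neg_distrib] at v
  rw [abs_le]
  constructor <;> linarith
end
end

section
/- There exist constants 0 < η, μ < 1 and c > 0 such that for every integer n ≥ 2 and every ε with 2^{−μ·n/log n} ≤ ε ≤ η, there exists a non-malleable code in the 2-split-state model with block length 2n, message length k ≥ c·n·(log log log(1/ε))/(log log(1/ε)) (that is, rate at least c·(log log log(1/ε))/(log log(1/ε))), and error at most ε. -/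
noncomputable section

/-- `(Enc, Dec)` is a non-malleable code in the 2-split-state model with message length `k`,
block length `2n` and error `ε`.  `Enc x` is a distribution on `{0,1}^n × {0,1}^n`, decoding
is always correct on the support of `Enc x`, and for every pair of tampering functions `f, g`
there is a distribution `G` over trivial manipulations (`none` = identity, `some c` = the
constant function `c`) such that for every message `x` the tampered decoding
`Dec(f(L), g(R))`, `(L,R) ~ Enc x`, is `ε`-close to `h(x)`, `h ~ G`. -/
def IsNMCode {n k : ℕ} (Enc : BS k → BS n × BS n → ℝ)
    (Dec : BS n × BS n → BS k) (ε : ℝ) : Prop :=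
  (∀ x, IsDist (Enc x)) ∧
  (∀ x c, 0 < Enc x c → Dec c = x) ∧
  ∀ f g : BS n → BS n,
    ∃ G : Option (BS k) → ℝ, IsDist G ∧
      ∀ x : BS k,
        sd (distMap (fun c : BS n × BS n => Dec (f c.1, g c.2)) (Enc x))
           (distMap (fun o : Option (BS k) => o.getD x) G) ≤ ε


section Prob

variable {Z M : Type} [Fintype Z] [DecidableEq Z] [Fintype M] [DecidableEq M]

lemma one_coord_s6 (m : M) (b s : ℝ) (hb0 : 0 ≤ b) (hb1 : b ≤ 1) (hs : |s| ≤ 1) :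
    ∑ m' : M, Real.exp (s * (b * ((if m' = m then (1:ℝ) else 0) - 1 / (Fintype.card M : ℝ))))
      ≤ (Fintype.card M : ℝ) * Real.exp (s ^ 2) := by
  have : Nonempty M := ⟨m⟩
  have hK : (1:ℝ) ≤ (Fintype.card M : ℝ) := by
    exact_mod_cast Fintype.card_pos
  set K : ℝ := (Fintype.card M : ℝ) with hKdef
  have hKi : 0 ≤ 1 / K ∧ 1 / K ≤ 1 := by
    constructor
    · positivity
    · rw [div_le_one (by linarith)]; exact hK
  have key : ∀ m' : M, Real.exp (s * (b * ((if m' = m then (1:ℝ) else 0) - 1 / K)))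
      ≤ 1 + s * (b * ((if m' = m then (1:ℝ) else 0) - 1 / K)) + s ^ 2 := by
    intro m'
    set w : ℝ := b * ((if m' = m then (1:ℝ) else 0) - 1 / K) with hw
    have hw1 : |w| ≤ 1 := by
      rw [hw, abs_mul, abs_of_nonneg hb0]
      have : |(if m' = m then (1:ℝ) else 0) - 1 / K| ≤ 1 := by
        rw [abs_le]; split_ifs <;> constructor <;> linarith [hKi.1, hKi.2]
      calc b * _ ≤ 1 * 1 := by gcongr
        _ = 1 := by ring
    have hsw : |s * w| ≤ 1 := by
      rw [abs_mul]
      calc |s| * |w| ≤ 1 * 1 := by gcongr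
        _ = 1 := by ring
    have h1 := (abs_le.mp (Real.abs_exp_sub_one_sub_id_le hsw)).2
    have h2 : (s * w) ^ 2 ≤ s ^ 2 := by
      rw [mul_pow]
      have : w ^ 2 ≤ 1 := by rw [← sq_abs]; exact pow_le_one₀ (abs_nonneg _) hw1
      nlinarith [sq_nonneg s]
    linarith
  refine (Finset.sum_le_sum (fun m' _ => key m')).trans ?_
  rw [Finset.sum_add_distrib, Finset.sum_add_distrib, ← Finset.mul_sum, ← Finset.mul_sum,
    Finset.sum_sub_distrib]
  simp only [Finset.sum_ite_eq', Finset.mem_univ, if_true, Finset.sum_const, Finset.card_univ,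
    nsmul_eq_mul, ← hKdef]
  have : K * (1 / K) = 1 := by field_simp
  rw [this]
  have := Real.add_one_le_exp (s ^ 2)
  nlinarith

lemma mgf_s6 (V : Finset Z) (a : (Z → M) → Z → ℝ) (m : M) (s : ℝ) (hs : |s| ≤ 1)
    (ha0 : ∀ D z, 0 ≤ a D z) (ha1 : ∀ D z, a D z ≤ 1)
    (hdep : ∀ D D' : Z → M, (∀ z, z ∉ V → D z = D' z) → ∀ z ∈ V, a D z = a D' z) :
    ∑ D : Z → M, Real.exp (s * ∑ z ∈ V,
        a D z * ((if D z = m then (1:ℝ) else 0) - 1 / (Fintype.card M : ℝ)))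
      ≤ (Fintype.card (Z → M) : ℝ) * Real.exp (s ^ 2 * (Fintype.card Z : ℝ)) := by
  have : Nonempty M := ⟨m⟩
  set K : ℝ := (Fintype.card M : ℝ) with hKdef
  let e := Equiv.piEquivPiSubtypeProd (fun z => z ∈ V) (fun _ : Z => M)
  rw [← Equiv.sum_comp e.symm, Fintype.sum_prod_type_right]
  have inner : ∀ w : {z // ¬ z ∈ V} → M,
      ∑ u : {z // z ∈ V} → M, Real.exp (s * ∑ z ∈ V,
        a (e.symm (u, w)) z * ((if e.symm (u, w) z = m then (1:ℝ) else 0) - 1 / K))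
      ≤ K ^ (Fintype.card {z // z ∈ V}) * Real.exp (s ^ 2 * (Fintype.card Z : ℝ)) := by
    intro w
    let b : {z // z ∈ V} → ℝ := fun z => a (e.symm (fun _ => m, w)) z
    have h1 : ∀ u : {z // z ∈ V} → M, Real.exp (s * ∑ z ∈ V,
        a (e.symm (u, w)) z * ((if e.symm (u, w) z = m then (1:ℝ) else 0) - 1 / K))
        = ∏ z : {z // z ∈ V}, Real.exp (s * (b z * ((if u z = m then (1:ℝ) else 0) - 1 / K))) := by
      intro u
      rw [← Real.exp_sum, ← Finset.mul_sum, ← Finset.sum_coe_sort V]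
      congr 2
      refine Finset.sum_congr rfl (fun z _ => ?_)
      have hz : e.symm (u, w) z = u z := by
        simp [e, Equiv.piEquivPiSubtypeProd]
      have hb : a (e.symm (u, w)) z = b z := by
        refine hdep _ _ (fun z' hz' => ?_) z z.2
        simp [e, Equiv.piEquivPiSubtypeProd, hz']
      rw [hz, hb]
    simp_rw [h1]
    have h2 := Fintype.prod_sum (fun (z : {z // z ∈ V}) (m' : M) =>
      Real.exp (s * (b z * ((if m' = m then (1:ℝ) else 0) - 1 / K))))
    rw [← h2]
    calc _ ≤ ∏ z : {z // z ∈ V}, (K * Real.exp (s ^ 2)) := by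
          refine Finset.prod_le_prod (fun _ _ => Finset.sum_nonneg (fun _ _ => (Real.exp_pos _).le))
            (fun z _ => ?_)
          exact one_coord_s6 m (b z) s (ha0 _ _) (ha1 _ _) hs
      _ = K ^ (Fintype.card {z // z ∈ V}) *
            Real.exp (s ^ 2 * (Fintype.card {z // z ∈ V} : ℝ)) := by
          rw [Finset.prod_const, Finset.card_univ, mul_pow, ← Real.exp_nat_mul]
          congr 2; ring
      _ ≤ _ := by
          gcongr
          exact Fintype.card_subtype_le _
  refine (Finset.sum_le_sum (fun w _ => inner w)).trans ?_
  rw [Finset.sum_const, Finset.card_univ, nsmul_eq_mul, ← mul_assoc]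
  have : (Fintype.card (Z → M) : ℝ) =
      (Fintype.card ({z // ¬ z ∈ V} → M) : ℝ) * K ^ (Fintype.card {z // z ∈ V}) := by
    rw [Fintype.card_congr e, Fintype.card_prod]
    push_cast
    rw [mul_comm, Fintype.card_fun (α := {z // z ∈ V})]
    push_cast; rfl
  rw [this]

lemma tail_s6 (V : Finset Z) (a : (Z → M) → Z → ℝ) (m : M) (δ : ℝ) (hδ0 : 0 ≤ δ) (hδ : δ ≤ 1)
    (ha0 : ∀ D z, 0 ≤ a D z) (ha1 : ∀ D z, a D z ≤ 1)
    (hdep : ∀ D D' : Z → M, (∀ z, z ∉ V → D z = D' z) → ∀ z ∈ V, a D z = a D' z) :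
    ((Finset.univ.filter (fun D : Z → M => δ * (Fintype.card Z : ℝ) < |∑ z ∈ V,
        a D z * ((if D z = m then (1:ℝ) else 0) - 1 / (Fintype.card M : ℝ))|)).card : ℝ)
      ≤ (Fintype.card (Z → M) : ℝ) * (2 * Real.exp (- (δ ^ 2 * (Fintype.card Z : ℝ) / 4))) := by
  set S : (Z → M) → ℝ := fun D => ∑ z ∈ V,
        a D z * ((if D z = m then (1:ℝ) else 0) - 1 / (Fintype.card M : ℝ)) with hS
  set N : ℝ := (Fintype.card Z : ℝ)
  have hs1 : |δ / 2| ≤ 1 := by rw [abs_of_nonneg (by linarith)]; linarith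
  have hs2 : |-(δ / 2)| ≤ 1 := by rwa [abs_neg]
  have m1 := mgf_s6 V a m (δ / 2) hs1 ha0 ha1 hdep
  have m2 := mgf_s6 V a m (-(δ / 2)) hs2 ha0 ha1 hdep
  have step : ((Finset.univ.filter (fun D : Z → M => δ * N < |S D|)).card : ℝ) *
      Real.exp (δ / 2 * (δ * N)) ≤
      ∑ D : Z → M, (Real.exp (δ / 2 * S D) + Real.exp (-(δ / 2) * S D)) := by
    rw [← nsmul_eq_mul, ← Finset.sum_const]
    refine (Finset.sum_le_sum ?_).trans
      (Finset.sum_le_univ_sum_of_nonneg (fun D => by positivity))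
    intro D hD
    have hD' : δ * N < |S D| := by simpa using hD
    rcases abs_cases (S D) with ⟨h, _⟩ | ⟨h, _⟩
    · have : Real.exp (δ / 2 * (δ * N)) ≤ Real.exp (δ / 2 * S D) := by
        apply Real.exp_le_exp.mpr
        apply mul_le_mul_of_nonneg_left _ (by linarith)
        linarith
      linarith [Real.exp_pos (-(δ / 2) * S D)]
    · have : Real.exp (δ / 2 * (δ * N)) ≤ Real.exp (-(δ / 2) * S D) := by
        apply Real.exp_le_exp.mpr
        rw [neg_mul_comm]
        apply mul_le_mul_of_nonneg_left _ (by linarith)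
        linarith
      linarith [Real.exp_pos ((δ / 2) * S D)]
  rw [Finset.sum_add_distrib] at step
  have tot : ((Finset.univ.filter (fun D : Z → M => δ * N < |S D|)).card : ℝ) *
      Real.exp (δ / 2 * (δ * N)) ≤
      (Fintype.card (Z → M) : ℝ) * (2 * Real.exp ((δ / 2) ^ 2 * N)) := by
    rw [neg_sq] at m2
    linarith
  have e1 : Real.exp (- (δ ^ 2 * N / 4)) * Real.exp (δ / 2 * (δ * N))
      = Real.exp ((δ / 2) ^ 2 * N) := by
    rw [← Real.exp_add]; congr 1; ring
  rw [← e1] at tot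
  have hp := Real.exp_pos (δ / 2 * (δ * N))
  refine le_of_mul_le_mul_right ?_ hp
  linarith

lemma exists_good_s6 {I : Type} [Fintype I] [Nonempty M] (V : I → Finset Z)
    (a : I → (Z → M) → Z → ℝ) (m : I → M) (δ : ℝ) (hδ0 : 0 ≤ δ) (hδ : δ ≤ 1)
    (ha0 : ∀ i D z, 0 ≤ a i D z) (ha1 : ∀ i D z, a i D z ≤ 1)
    (hdep : ∀ i, ∀ D D' : Z → M, (∀ z, z ∉ V i → D z = D' z) → ∀ z ∈ V i, a i D z = a i D' z)
    (hI : (Fintype.card I : ℝ) * (2 * Real.exp (- (δ ^ 2 * (Fintype.card Z : ℝ) / 4))) < 1) :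
    ∃ D : Z → M, ∀ i, |∑ z ∈ V i,
        a i D z * ((if D z = m i then (1:ℝ) else 0) - 1 / (Fintype.card M : ℝ))|
          ≤ δ * (Fintype.card Z : ℝ) := by
  by_contra hcon
  push Not at hcon
  let B : I → Finset (Z → M) := fun i => Finset.univ.filter
    (fun D : Z → M => δ * (Fintype.card Z : ℝ) < |∑ z ∈ V i,
        a i D z * ((if D z = m i then (1:ℝ) else 0) - 1 / (Fintype.card M : ℝ))|)
  have hcov : (Finset.univ : Finset (Z → M)) ⊆ Finset.univ.biUnion B := by
    intro D _
    obtain ⟨i, hi⟩ := hcon D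
    simp only [Finset.mem_biUnion, Finset.mem_univ, true_and]
    exact ⟨i, by simpa [B] using hi⟩
  have h1 : (Fintype.card (Z → M) : ℝ) ≤ ∑ i, ((B i).card : ℝ) := by
    have := (Finset.card_le_card hcov).trans Finset.card_biUnion_le
    rw [Finset.card_univ] at this
    exact_mod_cast this
  have h2 : ∑ i, ((B i).card : ℝ) ≤ ∑ i : I, (Fintype.card (Z → M) : ℝ) *
      (2 * Real.exp (- (δ ^ 2 * (Fintype.card Z : ℝ) / 4))) :=
    Finset.sum_le_sum (fun i _ => tail_s6 (V i) (a i) (m i) δ hδ0 hδ (ha0 i) (ha1 i) (hdep i))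
  rw [Finset.sum_const, Finset.card_univ, nsmul_eq_mul] at h2
  have hpos : (0:ℝ) < (Fintype.card (Z → M) : ℝ) := by exact_mod_cast Fintype.card_pos
  nlinarith

end Prob

lemma exists_col (n : ℕ) (h : BS n × BS n → BS n × BS n) :
    ∃ col : BS n × BS n → Option ((Fin n ⊕ Fin n) × Bool),
      ∀ z, h z ≠ z → col (h z) ≠ col z := by
  classical
  let bit : BS n × BS n → Fin n ⊕ Fin n → Bool := fun z => Sum.elim z.1 z.2
  have hex : ∀ z, h z ≠ z → ∃ j, bit (h z) j ≠ bit z j := by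
    intro z hz
    by_contra hc
    push Not at hc
    apply hz
    ext i
    · exact congrArg (· = true) (hc (Sum.inl i)) |>.to_iff |> fun t => by simpa [bit] using t
    · exact congrArg (· = true) (hc (Sum.inr i)) |>.to_iff |> fun t => by simpa [bit] using t
  refine ⟨fun z => if hz : h z ≠ z then
    some ((hex z hz).choose, bit z (hex z hz).choose) else none, ?_⟩
  intro z hz heq
  have hspec := (hex z hz).choose_spec
  by_cases h2 : h (h z) ≠ h z
  · simp only [dif_pos hz, dif_pos h2, Option.some.injEq, Prod.mk.injEq] at heq
    obtain ⟨e1, e2⟩ := heq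
    rw [e1] at e2
    exact hspec e2
  · simp only [dif_pos hz, dif_neg h2] at heq
    exact absurd heq (by simp)

/-- coefficient -/
def coef {n k : ℕ} (h : BS n × BS n → BS n × BS n) (x m' : BS k)
    (D : BS n × BS n → BS k) (z : BS n × BS n) : ℝ :=
  if h z = z then (if x = m' then 1 else 0) else (if D (h z) = m' then 1 else 0)

lemma exists_dec (n k : ℕ) (δ : ℝ) (hδ0 : 0 ≤ δ) (hδ : δ ≤ 1)
    (hI : ((2:ℝ) ^ (n * 2 ^ n) * (2:ℝ) ^ (n * 2 ^ n) * 2 ^ k * 2 ^ k * (4 * n + 1)) *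
      (2 * Real.exp (- (δ ^ 2 * ((2:ℝ) ^ n * 2 ^ n) / 4))) < 1) :
    ∃ D : BS n × BS n → BS k, ∀ f g : BS n → BS n, ∀ x m' : BS k,
      |∑ z : BS n × BS n, coef (fun c => (f c.1, g c.2)) x m' D z *
        ((if D z = x then (1:ℝ) else 0) - 1 / (2:ℝ) ^ k)|
        ≤ (4 * n + 1) * (δ * ((2:ℝ) ^ n * 2 ^ n)) := by
  classical
  choose col hcol using exists_col n
  let C := Option ((Fin n ⊕ Fin n) × Bool)
  let I := (BS n → BS n) × (BS n → BS n) × BS k × BS k × C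
  let hh : I → BS n × BS n → BS n × BS n := fun i c => (i.1 c.1, i.2.1 c.2)
  have hcC : Fintype.card C = 4 * n + 1 := by
    simp only [C, Fintype.card_option, Fintype.card_prod, Fintype.card_sum, Fintype.card_fin,
      Fintype.card_bool]
    ring
  have hcI : (Fintype.card I : ℝ) =
      (2:ℝ) ^ (n * 2 ^ n) * (2:ℝ) ^ (n * 2 ^ n) * 2 ^ k * 2 ^ k * (4 * n + 1) := by
    simp only [I, Fintype.card_prod, hcC]
    simp only [Fintype.card_fun, Fintype.card_fin, Fintype.card_bool, ← pow_mul]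
    push_cast; ring
  have hcZ : (Fintype.card (BS n × BS n) : ℝ) = (2:ℝ) ^ n * 2 ^ n := by
    simp [BS]
  have hcM : (Fintype.card (BS k) : ℝ) = (2:ℝ) ^ k := by
    simp [BS]
  obtain ⟨D, hD⟩ := exists_good_s6 (Z := BS n × BS n) (M := BS k) (I := I)
    (fun i => Finset.univ.filter (fun z => col (hh i) z = i.2.2.2.2))
    (fun i D z => coef (hh i) i.2.2.1 i.2.2.2.1 D z)
    (fun i => i.2.2.1) δ hδ0 hδ
    (fun i D z => by unfold coef; split_ifs <;> norm_num)
    (fun i D z => by unfold coef; split_ifs <;> norm_num)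
    (by
      intro i D D' hDD z hz
      unfold coef
      by_cases hf : hh i z = z
      · simp [hf]
      · have : D (hh i z) = D' (hh i z) := by
          apply hDD
          simp only [Finset.mem_filter, Finset.mem_univ, true_and] at hz ⊢
          rw [← hz]
          exact hcol _ _ hf
        simp only [hf, this])
    (by rw [hcI, hcZ]; exact hI)
  refine ⟨D, fun f g x m' => ?_⟩
  rw [hcZ, hcM] at hD
  rw [← Finset.sum_fiberwise (s := Finset.univ) (g := col (fun c => (f c.1, g c.2)))]
  refine (Finset.abs_sum_le_sum_abs _ _).trans ?_
  refine (Finset.sum_le_sum (fun j _ => hD (f, g, x, m', j))).trans ?_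
  rw [Finset.sum_const, Finset.card_univ, nsmul_eq_mul]
  have : (Fintype.card C : ℝ) = 4 * n + 1 := by rw [hcC]; push_cast; ring
  change (Fintype.card C : ℝ) * _ ≤ _
  rw [this]

lemma nm_of_dec (n k : ℕ) (D : BS n × BS n → BS k) (β ε : ℝ) (hβ : 0 ≤ β)
    (hD : ∀ f g : BS n → BS n, ∀ x m' : BS k,
      |∑ z : BS n × BS n, coef (fun c => (f c.1, g c.2)) x m' D z *
        ((if D z = x then (1:ℝ) else 0) - 1 / (2:ℝ) ^ k)| ≤ β * ((2:ℝ) ^ n * 2 ^ n))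
    (hε : 2 * (2:ℝ) ^ k * 2 ^ k * β ≤ ε) (hε1 : ε ≤ 1) :
    ∃ Enc : BS k → BS n × BS n → ℝ, IsNMCode Enc D ε := by
  classical
  set N : ℝ := (2:ℝ) ^ n * 2 ^ n with hN
  set K : ℝ := (2:ℝ) ^ k with hK
  have hNpos : 0 < N := by positivity
  have hK1 : 1 ≤ K := one_le_pow₀ (by norm_num)
  have hcZ : (Fintype.card (BS n × BS n) : ℝ) = N := by simp [BS, hN]
  have hcM : (Fintype.card (BS k) : ℝ) = K := by simp [BS, hK]
  let A : BS k → ℝ := fun x => ∑ z, if D z = x then (1:ℝ) else 0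
  have hA : ∀ x, |A x - N / K| ≤ β * N := by
    intro x
    have := hD id id x x
    simp only [coef, id, if_true, one_mul, Finset.sum_sub_distrib, Finset.sum_const,
      Finset.card_univ, nsmul_eq_mul, hcZ] at this
    rwa [mul_one_div] at this
  have hβK : 2 * K * β ≤ 1 := by
    have : 2 * K * β ≤ 2 * K * K * β := by
      have h0 : 0 ≤ 2 * K * β := by positivity
      nlinarith
    linarith
  have hApos : ∀ x, N ≤ 2 * K * A x := by
    intro x
    have h1 := (abs_le.mp (hA x)).1
    have h2 : K * (N / K) = N := by field_simp
    have h3 : 2 * K * β * N ≤ 1 * N := by gcongr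
    nlinarith
  have hApos' : ∀ x, 0 < A x := by
    intro x
    have h := hApos x
    by_contra hc
    push Not at hc
    have : 2 * K * A x ≤ 0 := mul_nonpos_of_nonneg_of_nonpos (by positivity) hc
    linarith
  refine ⟨fun x z => if D z = x then 1 / A x else 0, ?_, ?_, ?_⟩
  · intro x
    refine ⟨fun z => ?_, ?_⟩
    · dsimp only
      split_ifs
      · exact (one_div_pos.mpr (hApos' x)).le
      · exact le_rfl
    · have : ∀ z, (if D z = x then 1 / A x else 0) = (if D z = x then (1:ℝ) else 0) * (1 / A x) := by
        intro z; split_ifs <;> ring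
      simp_rw [this]
      rw [← Finset.sum_mul]
      change A x * (1 / A x) = 1
      rw [mul_one_div, div_self (hApos' x).ne']
  · intro x c hc
    by_contra h
    simp [h] at hc
  · intro f g
    let h : BS n × BS n → BS n × BS n := fun c => (f c.1, g c.2)
    let G : Option (BS k) → ℝ := fun o => match o with
      | none => (∑ z, if h z = z then (1:ℝ) else 0) / N
      | some m => (∑ z, if h z = z then (0:ℝ) else if D (h z) = m then 1 else 0) / N
    have hG0 : ∀ o, 0 ≤ G o := by
      intro o
      cases o with
      | none => exact div_nonneg (Finset.sum_nonneg fun z _ => by split_ifs <;> norm_num) hNpos.le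
      | some m => exact div_nonneg (Finset.sum_nonneg fun z _ => by split_ifs <;> norm_num) hNpos.le
    have hG1 : ∑ o, G o = 1 := by
      rw [Fintype.sum_option]
      simp only [G]
      rw [← Finset.sum_div, ← add_div, Finset.sum_comm, ← Finset.sum_add_distrib,
        div_eq_one_iff_eq hNpos.ne', ← hcZ]
      have : ∀ z, ((if h z = z then (1:ℝ) else 0) +
          ∑ m, if h z = z then (0:ℝ) else if D (h z) = m then 1 else 0) = 1 := by
        intro z
        by_cases hz : h z = z <;> simp [hz]
      rw [Finset.sum_congr rfl (fun z _ => this z)]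
      simp
    refine ⟨G, ⟨hG0, hG1⟩, fun x => ?_⟩
    let P : BS k → ℝ := fun m' => (if x = m' then G none else 0) + G (some m')
    have hP : distMap (fun o : Option (BS k) => o.getD x) G = P := by
      funext m'
      simp only [distMap, P]
      rw [Fintype.sum_option]
      simp
    have hP1 : ∀ m', P m' ≤ 1 := by
      intro m'
      rw [← hP, ← hG1]
      simp only [distMap]
      refine Finset.sum_le_sum fun o _ => ?_
      split_ifs
      · exact le_rfl
      · exact hG0 o
    have hP0 : ∀ m', 0 ≤ P m' := by
      intro m'
      simp only [P]
      have := hG0 none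
      have := hG0 (some m')
      split_ifs <;> linarith
    let T : BS k → ℝ := fun m' => ∑ z, if D (h z) = m' then (if D z = x then (1:ℝ) else 0) else 0
    have hT : distMap (fun c : BS n × BS n => D (f c.1, g c.2))
        (fun z => if D z = x then 1 / A x else 0) = fun m' => T m' / A x := by
      funext m'
      simp only [distMap, T]
      rw [Finset.sum_div]
      refine Finset.sum_congr rfl fun z _ => ?_
      change (if D (h z) = m' then _ else _) = _
      split_ifs <;> simp
    have hTP : ∀ m', |T m' - N / K * P m'| ≤ β * N := by
      intro m'
      have hk := hD f g x m'
      have : T m' - N / K * P m' = ∑ z : BS n × BS n, coef h x m' D z *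
        ((if D z = x then (1:ℝ) else 0) - 1 / K) := by
        have e1 : N / K * P m' = ∑ z, coef h x m' D z * (1 / K) := by
          have e2 : N * P m' = ∑ z, coef h x m' D z := by
            simp only [P, G]
            have : (if x = m' then (∑ z, if h z = z then (1:ℝ) else 0) / N else 0)
                = (∑ z, if h z = z then (if x = m' then (1:ℝ) else 0) else 0) / N := by
              split_ifs <;> simp
            rw [this, ← add_div, mul_div_cancel₀ _ hNpos.ne', ← Finset.sum_add_distrib]
            refine Finset.sum_congr rfl fun z _ => ?_
            unfold coef
            by_cases hz : h z = z <;> simp [hz]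
          rw [← Finset.sum_mul, ← e2]; ring
        rw [e1, ← Finset.sum_sub_distrib]
        refine Finset.sum_congr rfl fun z _ => ?_
        rw [mul_sub]
        congr 1
        unfold coef
        by_cases hz : h z = z
        · simp only [hz, if_true]
          by_cases h1 : D z = x
          · simp [h1]
          · simp [h1]
        · simp only [hz, if_false]
          split_ifs <;> simp
      rw [this]
      exact hk
    change sd (distMap (fun c : BS n × BS n => D (f c.1, g c.2))
        (fun z => if D z = x then 1 / A x else 0)) _ ≤ ε
    rw [hT, hP]
    have hpt : ∀ m', |T m' / A x - P m'| ≤ 4 * K * β := by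
      intro m'
      have hAx := hApos' x
      have e : T m' / A x - P m' = (T m' - A x * P m') / A x := by field_simp
      rw [e, abs_div, abs_of_pos hAx, div_le_iff₀ hAx]
      have e2 : T m' - A x * P m' = (T m' - N / K * P m') - (A x - N / K) * P m' := by ring
      rw [e2]
      have b1 : |(A x - N / K) * P m'| ≤ β * N := by
        rw [abs_mul, abs_of_nonneg (hP0 m')]
        calc _ ≤ (β * N) * 1 := by
              gcongr
              · exact hA x
              · exact hP1 m'
          _ = β * N := by ring
      have b2 := abs_sub (T m' - N / K * P m') ((A x - N / K) * P m')
      have b3 := hTP m'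
      have b4 := mul_le_mul_of_nonneg_left (hApos x) hβ
      linarith
    unfold sd
    have : ∑ m', |T m' / A x - P m'| ≤ K * (4 * K * β) := by
      refine (Finset.sum_le_sum fun m' _ => hpt m').trans ?_
      rw [Finset.sum_const, Finset.card_univ, nsmul_eq_mul, hcM]
    linarith

lemma numeric_union (n q : ℕ) (hq : 1 ≤ q) (h1 : 32 * q ≤ n) (h2 : n < 32 * (q + 1)) :
    ((2:ℝ) ^ (n * 2 ^ n) * (2:ℝ) ^ (n * 2 ^ n) * 2 ^ q * 2 ^ q * (4 * n + 1)) *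
      (2 * Real.exp (- ((1 / (2:ℝ) ^ (8 * q)) ^ 2 * ((2:ℝ) ^ n * 2 ^ n) / 4))) < 1 := by
  have hb : (4 * (n:ℝ) + 1) ≤ 2 ^ (4 * n) := by
    have : 4 * n + 1 ≤ 2 ^ (4 * n) := Nat.lt_two_pow_self
    exact_mod_cast this
  -- the exponent
  have hexp : (2:ℝ) ^ n * 2 ^ (16 * q) ≤ (1 / (2:ℝ) ^ (8 * q)) ^ 2 * ((2:ℝ) ^ n * 2 ^ n) := by
    have e : (1 / (2:ℝ) ^ (8 * q)) ^ 2 = 1 / 2 ^ (16 * q) := by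
      rw [div_pow, ← pow_mul]; norm_num; ring
    rw [e, one_div, mul_left_comm]
    gcongr
    rw [le_inv_mul_iff₀ (by positivity), ← pow_add]
    exact pow_le_pow_right₀ (by norm_num) (by omega)
  have hbern : 40 * n + 1 ≤ 2 ^ (16 * q) := by
    have hb : ∀ r : ℕ, 1280 * ((r + 1) + 1) + 1 ≤ 2 ^ (16 * (r + 1)) := by
      intro r
      induction r with
      | zero => norm_num
      | succ r ih =>
        have : 2 ^ (16 * (r + 1 + 1)) = 65536 * 2 ^ (16 * (r + 1)) := by
          rw [show 16 * (r + 1 + 1) = 16 + 16 * (r + 1) by ring, pow_add]; norm_num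
        omega
    obtain ⟨r, rfl⟩ : ∃ r, q = r + 1 := ⟨q - 1, by omega⟩
    have := hb r
    omega
  have hE : n * 2 ^ n + n * 2 ^ n + q + q + 4 * n + 1 ≤ 10 * n * 2 ^ n := by
    have hp : 1 ≤ 2 ^ n := Nat.one_le_two_pow
    have : n ≤ n * 2 ^ n := Nat.le_mul_of_pos_right n hp
    have : 10 * n * 2 ^ n = 10 * (n * 2 ^ n) := by ring
    omega
  have hL : ((2:ℝ) ^ (n * 2 ^ n) * (2:ℝ) ^ (n * 2 ^ n) * 2 ^ q * 2 ^ q * (4 * n + 1)) * 2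
      ≤ 2 ^ (10 * n * 2 ^ n) := by
    calc _ ≤ ((2:ℝ) ^ (n * 2 ^ n) * (2:ℝ) ^ (n * 2 ^ n) * 2 ^ q * 2 ^ q * 2 ^ (4 * n)) * 2 ^ 1 := by
          rw [pow_one]; gcongr
      _ = 2 ^ (n * 2 ^ n + n * 2 ^ n + q + q + 4 * n + 1) := by
          simp only [pow_add]
      _ ≤ _ := pow_le_pow_right₀ (by norm_num) hE
  have hL2 : (2:ℝ) ^ (10 * n * 2 ^ n) ≤ Real.exp ((10 * n * 2 ^ n : ℕ) : ℝ) := by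
    rw [← Real.exp_one_pow]
    have : (2:ℝ) ≤ Real.exp 1 := by linarith [Real.add_one_le_exp (1:ℝ)]
    gcongr
  rw [← mul_assoc]
  refine lt_of_le_of_lt (mul_le_mul_of_nonneg_right (hL.trans hL2) (Real.exp_pos _).le) ?_
  rw [← Real.exp_add, Real.exp_lt_one_iff]
  have hb' : (40 * (n:ℝ) + 1) ≤ 2 ^ (16 * q) := by exact_mod_cast hbern
  have hpn : (0:ℝ) < 2 ^ n := by positivity
  have := mul_le_mul_of_nonneg_left hb' hpn.le
  push_cast
  nlinarith

lemma numeric_err (n q : ℕ) (hq : 2 ≤ q) (h2 : n < 32 * (q + 1)) :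
    2 * (2:ℝ) ^ q * 2 ^ q * ((4 * n + 1) * (1 / (2:ℝ) ^ (8 * q))) ≤ 1 / 2 ^ q := by
  have hb : ∀ r : ℕ, 256 * ((r + 2) + 1) ≤ 2 ^ (5 * (r + 2)) := by
    intro r
    induction r with
    | zero => norm_num
    | succ r ih =>
      have : 2 ^ (5 * (r + 1 + 2)) = 32 * 2 ^ (5 * (r + 2)) := by
        rw [show 5 * (r + 1 + 2) = 5 + 5 * (r + 2) by ring, pow_add]; norm_num
      omega
  have h5 : 2 * (4 * n + 1) ≤ 2 ^ (5 * q) := by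
    obtain ⟨r, rfl⟩ : ∃ r, q = r + 2 := ⟨q - 2, by omega⟩
    have := hb r
    omega
  have h5' : 2 * (4 * (n:ℝ) + 1) ≤ 2 ^ (5 * q) := by exact_mod_cast h5
  have e8 : (2:ℝ) ^ (8 * q) = 2 ^ (5 * q) * 2 ^ q * 2 ^ q * 2 ^ q := by
    rw [← pow_add, ← pow_add, ← pow_add]; congr 1; ring
  rw [e8]
  have hp : (0:ℝ) < 2 ^ q := by positivity
  have hp5 : (0:ℝ) < 2 ^ (5 * q) := by positivity
  have e : 2 * (2:ℝ) ^ q * 2 ^ q * ((4 * n + 1) * (1 / (2 ^ (5 * q) * 2 ^ q * 2 ^ q * 2 ^ q)))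
      = (2 * (4 * (n:ℝ) + 1) / 2 ^ (5 * q)) * (1 / 2 ^ q) := by
    field_simp
  rw [e]
  have : 2 * (4 * (n:ℝ) + 1) / 2 ^ (5 * q) ≤ 1 := by rwa [div_le_one hp5]
  have h0 : (0:ℝ) ≤ 1 / 2 ^ q := by positivity
  nlinarith

theorem stmt6 :
    ∃ η μ c : ℝ, 0 < η ∧ η < 1 ∧ 0 < μ ∧ μ < 1 ∧ 0 < c ∧
      ∀ n : ℕ, 2 ≤ n → ∀ ε : ℝ,
        (2 : ℝ) ^ (-(μ * n / log2 n)) ≤ ε → ε ≤ η →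
        ∃ (k : ℕ) (Enc : BS k → BS n × BS n → ℝ) (Dec : BS n × BS n → BS k),
          c * n * (log2 (log2 (log2 (1 / ε))) / log2 (log2 (1 / ε))) ≤ (k : ℝ) ∧
          IsNMCode Enc Dec ε := by
  refine ⟨(2:ℝ) ^ (-(64:ℝ)), 1 / 64, 1 / 128, by positivity, ?_, by norm_num, by norm_num,
    by norm_num, ?_⟩
  · exact Real.rpow_lt_one_of_one_lt_of_neg (by norm_num) (by norm_num)
  intro n hn ε hε1 hε2
  have hnR : (2:ℝ) ≤ n := by exact_mod_cast hn
  have hεpos : 0 < ε := lt_of_lt_of_le (by positivity) hε1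
  have hlogn : 1 ≤ log2 n := by
    unfold log2
    rw [Real.le_logb_iff_rpow_le (by norm_num) (by linarith), Real.rpow_one]
    exact hnR
  have hdiv : 1 / 64 * (n:ℝ) / log2 n ≤ 1 / 64 * n := div_le_self (by positivity) hlogn
  have hn64 : 64 ≤ n := by
    have h := hε1.trans hε2
    rw [Real.rpow_le_rpow_left_iff (by norm_num)] at h
    have : (64:ℝ) ≤ n := by linarith
    exact_mod_cast this
  obtain ⟨q, hq⟩ : ∃ q, q = n / 32 := ⟨_, rfl⟩
  have hq2 : 2 ≤ q := by omega
  have hq32 : 32 * q ≤ n := by omega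
  have hqn : n < 32 * (q + 1) := by omega
  have hn64q : (n:ℝ) ≤ 64 * q := by
    have : n ≤ 64 * q := by omega
    exact_mod_cast this
  have hεq : 1 / (2:ℝ) ^ q ≤ ε := by
    refine le_trans ?_ hε1
    rw [one_div, ← Real.rpow_natCast, ← Real.rpow_neg (by norm_num),
      Real.rpow_le_rpow_left_iff (by norm_num)]
    linarith
  have hε1' : ε ≤ 1 := hε2.trans
    (Real.rpow_lt_one_of_one_lt_of_neg (by norm_num) (by norm_num)).le
  obtain ⟨D, hD⟩ := exists_dec n q (1 / (2:ℝ) ^ (8 * q)) (by positivity)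
    (by rw [div_le_one (by positivity)]; exact one_le_pow₀ (by norm_num))
    (numeric_union n q (by omega) hq32 hqn)
  obtain ⟨Enc, hEnc⟩ := nm_of_dec n q D ((4 * n + 1) * (1 / (2:ℝ) ^ (8 * q))) ε (by positivity)
    (by intro f g x m'; rw [mul_assoc]; exact hD f g x m')
    ((numeric_err n q hq2 hqn).trans hεq) hε1'
  refine ⟨q, Enc, D, ?_, hEnc⟩
  -- the rate
  have hl1 : 64 ≤ log2 (1 / ε) := by
    unfold log2
    rw [Real.le_logb_iff_rpow_le (by norm_num) (by positivity), le_div_iff₀ hεpos]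
    calc (2:ℝ) ^ (64:ℝ) * ε ≤ (2:ℝ) ^ (64:ℝ) * (2:ℝ) ^ (-(64:ℝ)) := by gcongr
      _ = 1 := by rw [← Real.rpow_add (by norm_num)]; norm_num
  have hl2 : 1 ≤ log2 (log2 (1 / ε)) := by
    rw [log2, Real.le_logb_iff_rpow_le (by norm_num) (by linarith), Real.rpow_one]
    linarith
  set t := log2 (log2 (1 / ε)) with ht
  have hratio : log2 t / t ≤ 2 := by
    rw [div_le_iff₀ (by linarith)]
    unfold log2
    rw [Real.logb, div_le_iff₀ (Real.log_pos (by norm_num))]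
    have a1 := Real.log_le_sub_one_of_pos (show 0 < t by linarith)
    have a2 := Real.log_two_gt_d9
    nlinarith
  calc 1 / 128 * (n:ℝ) * (log2 t / t) ≤ 1 / 128 * (n:ℝ) * 2 := by gcongr
    _ ≤ q := by linarith
end
end

section
/- There exist constants c, c' > 0 and an integer n0 such that for every integer n ≥ n0 there exists a non-malleable code in the 2-split-state model with block length 2n, message length k ≥ c·n·(log log n)/log n (that is, rate at least c·(log log n)/log n), and error at most 2^{−c'·n·(log log n)/log n}. -/
noncomputable section

lemma nm_factor {M : Type*} [Fintype M] [DecidableEq M] (x : M) (l : ℝ) (hl : |l| ≤ 1)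
    (P : Prop) [Decidable P] :
    ∑ v : M, Real.exp (l * (if P then ((if v = x then (1:ℝ) else 0) - 1 / (Fintype.card M : ℝ))
      else 0)) ≤ (Fintype.card M : ℝ) * Real.exp (l ^ 2) := by
  have hK : (0:ℝ) < Fintype.card M := by
    exact_mod_cast Fintype.card_pos_iff.mpr ⟨x⟩
  have hK1 : (1:ℝ) ≤ Fintype.card M := by
    exact_mod_cast Fintype.card_pos_iff.mpr ⟨x⟩
  by_cases hP : P
  · simp only [hP, if_true]
    set K : ℝ := (Fintype.card M : ℝ) with hKdef
    have hinv : 1 / K ≤ 1 := by rw [div_le_one hK]; exact hK1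
    have hinv0 : 0 < 1 / K := by positivity
    have hb : ∀ v : M, |(if v = x then (1:ℝ) else 0) - 1 / K| ≤ 1 := by
      intro v
      split_ifs <;> rw [abs_le] <;> constructor <;> linarith
    have h1 : ∀ v : M, Real.exp (l * ((if v = x then (1:ℝ) else 0) - 1 / K)) ≤
        1 + l * ((if v = x then (1:ℝ) else 0) - 1 / K) + l ^ 2 := by
      intro v
      set u := l * ((if v = x then (1:ℝ) else 0) - 1 / K) with hu
      have hul : |u| ≤ |l| := by
        rw [hu, abs_mul]
        exact mul_le_of_le_one_right (abs_nonneg _) (hb v)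
      have h2 := Real.abs_exp_sub_one_sub_id_le (hul.trans hl)
      have h3 := (abs_le.mp h2).2
      have h4 : u ^ 2 ≤ l ^ 2 := sq_le_sq.mpr hul
      linarith
    calc _ ≤ ∑ v : M, (1 + l * ((if v = x then (1:ℝ) else 0) - 1 / K) + l ^ 2) :=
          Finset.sum_le_sum fun v _ => h1 v
      _ = K * (l ^ 2 + 1) := by
          simp only [Finset.sum_add_distrib, ← Finset.mul_sum, Finset.sum_sub_distrib]
          simp [← hKdef]
          field_simp
          ring
      _ ≤ _ := by
          gcongr
          exact Real.add_one_le_exp _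
  · simp only [hP, if_false]
    simp
    nlinarith [Real.add_one_le_exp (l ^ 2), sq_nonneg l]

lemma nm_mgf {V M : Type*} [Fintype V] [DecidableEq V] [Fintype M] [DecidableEq M]
    (F : V → V) (C : Finset V) (hC : ∀ c ∈ C, F c ∉ C) (x y : M) (l : ℝ) (hl : |l| ≤ 1) :
    ∑ D : V → M, Real.exp (l * ∑ c ∈ C, (if D (F c) = y then
      ((if D c = x then (1:ℝ) else 0) - 1 / (Fintype.card M : ℝ)) else 0)) ≤
      (Fintype.card (V → M) : ℝ) * Real.exp (l ^ 2 * Fintype.card V) := by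
  classical
  let e := Equiv.piEquivPiSubtypeProd (fun c => c ∈ C) (fun _ : V => M)
  have hK : (0:ℝ) ≤ Fintype.card M := by positivity
  rw [← Equiv.sum_comp e.symm, Fintype.sum_prod_type_right]
  have hin : ∀ D2 : {c // ¬ c ∈ C} → M,
      ∑ D1 : {c // c ∈ C} → M, Real.exp (l * ∑ c ∈ C, (if e.symm (D1, D2) (F c) = y then
      ((if e.symm (D1, D2) c = x then (1:ℝ) else 0) - 1 / (Fintype.card M : ℝ)) else 0)) ≤
      ((Fintype.card M : ℝ) * Real.exp (l ^ 2)) ^ C.card := by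
    intro D2
    have h1 : ∀ D1 : {c // c ∈ C} → M, Real.exp (l * ∑ c ∈ C,
        (if e.symm (D1, D2) (F c) = y then
        ((if e.symm (D1, D2) c = x then (1:ℝ) else 0) - 1 / (Fintype.card M : ℝ)) else 0)) =
        ∏ c : {c // c ∈ C}, Real.exp (l * (if D2 ⟨F c, hC c c.2⟩ = y then
        ((if D1 c = x then (1:ℝ) else 0) - 1 / (Fintype.card M : ℝ)) else 0)) := by
      intro D1
      rw [← Finset.sum_coe_sort, Finset.mul_sum, Real.exp_sum]
      refine Finset.prod_congr rfl fun c _ => ?_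
      have e1 : e.symm (D1, D2) (F c) = D2 ⟨F c, hC c c.2⟩ := by
        simp [e, Equiv.piEquivPiSubtypeProd, hC c c.2]
      have e2 : e.symm (D1, D2) c = D1 c := by
        simp [e, Equiv.piEquivPiSubtypeProd]
      rw [e1, e2]
    simp only [h1]
    have h2 := Finset.prod_univ_sum (fun _ : {c // c ∈ C} => (Finset.univ : Finset M))
      (fun c v => Real.exp (l * (if D2 ⟨F c, hC c c.2⟩ = y then
        ((if v = x then (1:ℝ) else 0) - 1 / (Fintype.card M : ℝ)) else 0)))
    rw [Fintype.piFinset_univ] at h2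
    rw [← h2]
    calc _ ≤ ∏ c : {c // c ∈ C}, ((Fintype.card M : ℝ) * Real.exp (l ^ 2)) := by
          refine Finset.prod_le_prod (fun c _ => Finset.sum_nonneg fun v _ => (Real.exp_pos _).le)
            fun c _ => nm_factor x l hl _
      _ = _ := by simp
  calc _ ≤ ∑ D2 : {c // ¬ c ∈ C} → M, ((Fintype.card M : ℝ) * Real.exp (l ^ 2)) ^ C.card :=
        Finset.sum_le_sum fun D2 _ => hin D2
    _ = (Fintype.card M : ℝ) ^ Fintype.card V * Real.exp (l ^ 2 * C.card) := by
        have hle : C.card ≤ Fintype.card V := Finset.card_le_univ C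
        rw [Finset.sum_const, nsmul_eq_mul, Finset.card_univ, Fintype.card_fun, mul_pow,
          Fintype.card_subtype_compl, Fintype.card_coe, ← Real.exp_nat_mul]
        push_cast
        rw [← mul_assoc, ← pow_add, Nat.sub_add_cancel hle, mul_comm (C.card : ℝ)]
    _ ≤ _ := by
        rw [Fintype.card_fun]
        push_cast
        have hle : (C.card : ℝ) ≤ Fintype.card V := by exact_mod_cast Finset.card_le_univ C
        gcongr

/-- existence of a good decoder for a family of tampering functions -/
lemma nm_exists {V M Φ J : Type*} [Fintype V] [DecidableEq V] [Fintype M] [DecidableEq M]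
    [Fintype Φ] [Fintype J] [DecidableEq J] [Nonempty M] (F : Φ → V → V) (col : Φ → V → J)
    (hcol : ∀ φ c, F φ c ≠ c → col φ (F φ c) ≠ col φ c) (η : ℝ) (h0 : 0 < η) (h1 : η ≤ 1)
    (hbig : (Fintype.card (Φ × M × M × J × Bool) : ℝ) *
      Real.exp (- (η ^ 2 * Fintype.card V / 4)) < 1) :
    ∃ D : V → M, ∀ φ x y, |∑ c : V, (if F φ c ≠ c ∧ D (F φ c) = y then
      ((if D c = x then (1:ℝ) else 0) - 1 / (Fintype.card M : ℝ)) else 0)| ≤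
        Fintype.card J * (η * Fintype.card V) := by
  classical
  set m : ℝ := (Fintype.card V : ℝ) with hm
  let C : Φ → J → Finset V := fun φ j => Finset.univ.filter fun c => F φ c ≠ c ∧ col φ c = j
  let S : Φ → M → M → J → (V → M) → ℝ := fun φ x y j D => ∑ c ∈ C φ j, (if D (F φ c) = y then
      ((if D c = x then (1:ℝ) else 0) - 1 / (Fintype.card M : ℝ)) else 0)
  let sg : Bool → ℝ := fun b => if b then 1 else -1
  by_contra hcon
  push Not at hcon
  have hbad : ∀ D : V → M, ∃ p : Φ × M × M × J × Bool,
      η * m ≤ sg p.2.2.2.2 * S p.1 p.2.1 p.2.2.1 p.2.2.2.1 D := by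
    intro D
    obtain ⟨φ, x, y, h⟩ := hcon D
    by_contra hn
    push Not at hn
    refine absurd h (not_lt.mpr ?_)
    have hsplit : ∑ c : V, (if F φ c ≠ c ∧ D (F φ c) = y then
      ((if D c = x then (1:ℝ) else 0) - 1 / (Fintype.card M : ℝ)) else 0) =
        ∑ j, S φ x y j D := by
      rw [← Finset.sum_fiberwise (s := Finset.univ) (g := col φ)]
      refine Finset.sum_congr rfl fun j _ => ?_
      simp only [S, C]
      rw [Finset.sum_filter, Finset.sum_filter]
      refine Finset.sum_congr rfl fun c _ => ?_
      by_cases a1 : F φ c = c <;> by_cases a2 : col φ c = j <;> simp [a1, a2]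
    rw [hsplit]
    calc _ ≤ ∑ j, |S φ x y j D| := Finset.abs_sum_le_sum_abs _ _
      _ ≤ ∑ j : J, η * m := by
          refine Finset.sum_le_sum fun j _ => ?_
          have p1 := hn (φ, x, y, j, true)
          have p2 := hn (φ, x, y, j, false)
          simp [sg] at p1 p2
          rw [abs_le]; constructor <;> linarith
      _ = _ := by simp
  have hC : ∀ φ j, ∀ c ∈ C φ j, F φ c ∉ C φ j := by
    intro φ j c hc hc'
    simp only [C, Finset.mem_filter, Finset.mem_univ, true_and] at hc hc'
    exact hcol φ c hc.1 (hc'.2.trans hc.2.symm)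
  have hmg : ∀ p : Φ × M × M × J × Bool,
      ∑ D : V → M, Real.exp ((sg p.2.2.2.2 * (η / 2)) * S p.1 p.2.1 p.2.2.1 p.2.2.2.1 D) ≤
      (Fintype.card (V → M) : ℝ) * Real.exp (η ^ 2 * m / 4) := by
    rintro ⟨φ, x, y, j, b⟩
    have hsq : (sg b * (η / 2)) ^ 2 = η ^ 2 / 4 := by
      cases b <;> simp [sg] <;> ring
    have := nm_mgf (F φ) (C φ j) (hC φ j) x y (sg b * (η / 2)) (by
      rw [← sq_le_one_iff_abs_le_one, hsq]; nlinarith)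
    rw [hsq] at this
    convert this using 3
    ring
  have hpos : (0:ℝ) < Fintype.card (V → M) := by exact_mod_cast Fintype.card_pos
  have hfin : (Fintype.card (V → M) : ℝ) ≤ (Fintype.card (Φ × M × M × J × Bool) : ℝ) *
      ((Fintype.card (V → M) : ℝ) * Real.exp (- (η ^ 2 * m / 4))) := by
    calc (Fintype.card (V → M) : ℝ) = ∑ D : V → M, (1:ℝ) := by simp
      _ ≤ ∑ D : V → M, ∑ p : Φ × M × M × J × Bool, Real.exp ((sg p.2.2.2.2 * (η / 2)) *
            S p.1 p.2.1 p.2.2.1 p.2.2.2.1 D) * Real.exp (-(η ^ 2 * m / 2)) := by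
          refine Finset.sum_le_sum fun D _ => ?_
          obtain ⟨p, hp⟩ := hbad D
          refine le_trans ?_ (Finset.single_le_sum (f := fun p : Φ × M × M × J × Bool =>
            Real.exp ((sg p.2.2.2.2 * (η / 2)) *
            S p.1 p.2.1 p.2.2.1 p.2.2.2.1 D) * Real.exp (-(η ^ 2 * m / 2)))
            (fun _ _ => by positivity) (Finset.mem_univ p))
          rw [← Real.exp_add]
          apply Real.one_le_exp
          nlinarith [mul_le_mul_of_nonneg_left hp h0.le]
      _ = ∑ p : Φ × M × M × J × Bool, (∑ D : V → M, Real.exp ((sg p.2.2.2.2 * (η / 2)) *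
            S p.1 p.2.1 p.2.2.1 p.2.2.2.1 D)) * Real.exp (-(η ^ 2 * m / 2)) := by
          rw [Finset.sum_comm]
          simp only [Finset.sum_mul]
      _ ≤ ∑ p : Φ × M × M × J × Bool, ((Fintype.card (V → M) : ℝ) * Real.exp (η ^ 2 * m / 4)) *
            Real.exp (-(η ^ 2 * m / 2)) := by
          refine Finset.sum_le_sum fun p _ => ?_
          have := hmg p
          gcongr
      _ = _ := by
          rw [Finset.sum_const, nsmul_eq_mul, Finset.card_univ, mul_assoc (Fintype.card (V → M) : ℝ),
            ← Real.exp_add]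
          congr 4
          ring
  nlinarith


/-- the simulator: identity on fixed points, otherwise the decoded tampered value -/
def nmSim {M : Type*} [Fintype M] (B : M → ℝ) (m : ℝ) : Option M → ℝ
  | none => 1 - ∑ y, B y / m
  | some y => B y / m

lemma nm_sd {V M : Type*} [Fintype V] [DecidableEq V] [Fintype M] [DecidableEq M]
    [Nonempty V] (D : V → M) (F : V → V) (e : ℝ)
    (hF : ∀ x y, |∑ c : V, (if F c ≠ c ∧ D (F c) = y then
      ((if D c = x then (1:ℝ) else 0) - 1 / (Fintype.card M : ℝ)) else 0)| ≤ e)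
    (hn : ∀ x, |∑ c : V, (if D c = x then (1:ℝ) else 0) -
      (Fintype.card V : ℝ) / (Fintype.card M : ℝ)| ≤ (Fintype.card M : ℝ) * e)
    (hs : 2 * (Fintype.card M : ℝ) ^ 2 * e ≤ (Fintype.card V : ℝ)) :
    ∃ G : Option M → ℝ, IsDist G ∧ ∀ x : M,
      sd (distMap (fun c : V => D (F c))
          (fun c => if D c = x then 1 / ∑ c : V, (if D c = x then (1:ℝ) else 0) else 0))
        (distMap (fun o : Option M => o.getD x) G) ≤
        4 * (Fintype.card M : ℝ) ^ 2 * e / (Fintype.card V : ℝ) := by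
  classical
  set m : ℝ := (Fintype.card V : ℝ) with hm
  have hm0 : 0 < m := by rw [hm]; exact_mod_cast Fintype.card_pos
  have hMne : Nonempty M := ⟨D (Classical.arbitrary V)⟩
  set K : ℝ := (Fintype.card M : ℝ) with hK
  have hK0 : 0 < K := by rw [hK]; exact_mod_cast Fintype.card_pos
  have he0 : 0 ≤ e := (abs_nonneg _).trans (hF (Classical.arbitrary M) (Classical.arbitrary M))
  let B : M → ℝ := fun y => ∑ c : V, if F c ≠ c ∧ D (F c) = y then (1:ℝ) else 0
  have hB0 : ∀ y, 0 ≤ B y := fun y => Finset.sum_nonneg fun c _ => by split_ifs <;> norm_num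
  have hBsum : ∑ y, B y ≤ m := by
    simp only [B]
    rw [Finset.sum_comm]
    calc _ ≤ ∑ c : V, (1:ℝ) := by
          refine Finset.sum_le_sum fun c _ => ?_
          by_cases h : F c = c <;> simp [h]
      _ = m := by simp [hm]
  refine ⟨nmSim B m, ⟨?_, ?_⟩, ?_⟩
  · rintro (_ | y)
    · simp only [nmSim, ← Finset.sum_div]
      rw [sub_nonneg, div_le_one hm0]; exact hBsum
    · exact div_nonneg (hB0 y) hm0.le
  · rw [Fintype.sum_option]; simp [nmSim]
  intro x
  set N : ℝ := ∑ c : V, (if D c = x then (1:ℝ) else 0) with hN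
  have hNlow : m / (2 * K) ≤ N := by
    have h1 := (abs_le.mp (hn x)).1
    have h2 : K * e ≤ m / (2 * K) := by
      rw [le_div_iff₀ (by positivity)]; nlinarith
    have h3 : m / K = 2 * (m / (2 * K)) := by field_simp
    linarith
  have hN0 : 0 < N := lt_of_lt_of_le (by positivity) hNlow
  let A : M → ℝ := fun y => ∑ c : V, if F c ≠ c ∧ D (F c) = y then
    (if D c = x then (1:ℝ) else 0) else 0
  have hAB : ∀ y, |A y - B y / K| ≤ e := by
    intro y
    refine le_trans (le_of_eq ?_) (hF x y)
    congr 1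
    simp only [A, B]
    rw [Finset.sum_div, ← Finset.sum_sub_distrib]
    refine Finset.sum_congr rfl fun c _ => ?_
    split_ifs <;> simp
  have hd1 : ∀ y, distMap (fun c : V => D (F c)) (fun c => if D c = x then 1 / N else 0) y =
      A y / N + (if y = x then 1 - ∑ y', A y' / N else 0) := by
    intro y
    have hone : (1:ℝ) = ∑ c : V, (if D c = x then (1:ℝ) else 0) / N := by
      rw [← Finset.sum_div, ← hN, div_self hN0.ne']
    have hAs : ∑ y', A y' / N = ∑ c : V, (if F c ≠ c then
        (if D c = x then (1:ℝ) else 0) else 0) / N := by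
      rw [← Finset.sum_div, ← Finset.sum_div]
      congr 1
      simp only [A]
      rw [Finset.sum_comm]
      refine Finset.sum_congr rfl fun c _ => ?_
      by_cases h : F c = c <;> simp [h]
    rw [hAs]
    have hone' : (1:ℝ) - ∑ c : V, (if F c ≠ c then (if D c = x then (1:ℝ) else 0) else 0) / N =
        ∑ c : V, (if D c = x then (1:ℝ) else 0) / N -
        ∑ c : V, (if F c ≠ c then (if D c = x then (1:ℝ) else 0) else 0) / N := by
      rw [← hone]
    rw [hone']
    simp only [A, distMap]
    rw [← Finset.sum_sub_distrib, Finset.sum_div]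
    by_cases hyx : y = x
    · subst hyx
      simp only [if_true]
      rw [← Finset.sum_add_distrib]
      refine Finset.sum_congr rfl fun c _ => ?_
      by_cases h1 : F c = c
      · simp only [h1]
        by_cases h2 : D c = y <;> simp [h2]
      · by_cases h2 : D c = y <;> by_cases h3 : D (F c) = y <;> simp [h1, h2, h3]
    · simp only [hyx, if_false, add_zero]
      refine Finset.sum_congr rfl fun c _ => ?_
      by_cases h1 : F c = c
      · simp only [h1]
        by_cases h2 : D c = x <;> simp [h2, Ne.symm hyx]
      · by_cases h2 : D c = x <;> by_cases h3 : D (F c) = y <;> simp [h1, h2, h3]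
  have hd2 : ∀ y, distMap (fun o : Option M => o.getD x) (nmSim B m) y =
      B y / m + (if y = x then 1 - ∑ y', B y' / m else 0) := by
    intro y
    simp only [distMap]
    rw [Fintype.sum_option]
    simp [nmSim, eq_comm (a := x), add_comm]
  have hT : ∑ y, |A y / N - B y / m| ≤ 2 * (K * e / N) := by
    have h1 : ∀ y, |A y / N - B y / m| ≤ e / N + B y / m * (K * e / N) := by
      intro y
      have : A y / N - B y / m = (A y - B y / K) / N + B y / m * ((m / K - N) / N) := by
        field_simp
        ring
      rw [this]
      refine (abs_add_le _ _).trans ?_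
      rw [abs_div, abs_mul, abs_of_nonneg (div_nonneg (hB0 y) hm0.le), abs_div (m / K - N),
        abs_of_pos hN0]
      have h2 := hn x
      rw [abs_sub_comm] at h2
      have h3 := hAB y
      have h4 : 0 ≤ B y / m := div_nonneg (hB0 y) hm0.le
      gcongr
    calc _ ≤ ∑ y, (e / N + B y / m * (K * e / N)) := Finset.sum_le_sum fun y _ => h1 y
      _ = K * e / N + (∑ y, B y) / m * (K * e / N) := by
          have hdiv : ∑ y, B y / m = (∑ y, B y) / m := (Finset.sum_div _ _ _).symm
          rw [Finset.sum_add_distrib, ← Finset.sum_mul, hdiv]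
          rw [Finset.sum_const, nsmul_eq_mul, Finset.card_univ, ← hK]
          ring
      _ ≤ K * e / N + 1 * (K * e / N) := by
          gcongr
          rw [div_le_one hm0]; exact hBsum
      _ = _ := by ring
  have hsd : sd (distMap (fun c : V => D (F c)) (fun c => if D c = x then 1 / N else 0))
      (distMap (fun o : Option M => o.getD x) (nmSim B m)) ≤
      ∑ y, |A y / N - B y / m| := by
    unfold sd
    simp only [hd1, hd2]
    have h1 : ∀ y, |A y / N + (if y = x then 1 - ∑ y', A y' / N else 0) -
        (B y / m + (if y = x then 1 - ∑ y', B y' / m else 0))| ≤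
        |A y / N - B y / m| + (if y = x then ∑ y', |A y' / N - B y' / m| else 0) := by
      intro y
      by_cases h : y = x
      · simp only [h, if_true]
        have : A x / N + (1 - ∑ y', A y' / N) - (B x / m + (1 - ∑ y', B y' / m)) =
          (A x / N - B x / m) - ∑ y', (A y' / N - B y' / m) := by
          rw [Finset.sum_sub_distrib]; ring
        rw [this]
        refine (abs_sub _ _).trans ?_
        gcongr
        exact Finset.abs_sum_le_sum_abs _ _
      · simp [h]
    have h2 := Finset.sum_le_sum fun y (_ : y ∈ Finset.univ) => h1 y
    rw [Finset.sum_add_distrib] at h2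
    simp only [Finset.sum_ite_eq', Finset.mem_univ, if_true] at h2
    linarith
  refine hsd.trans (hT.trans ?_)
  calc 2 * (K * e / N) ≤ 2 * (K * e / (m / (2 * K))) := by gcongr
    _ = _ := by field_simp; ring

lemma nm_col {n : ℕ} (hn : 0 < n) (F : BS n × BS n → BS n × BS n) :
    ∃ col : BS n × BS n → (Fin n ⊕ Fin n) × Bool, ∀ c, F c ≠ c → col (F c) ≠ col c := by
  classical
  let bit : (Fin n ⊕ Fin n) → BS n × BS n → Bool := fun i c => Sum.elim c.1 c.2 i
  have hsep : ∀ c, F c ≠ c → ∃ i, bit i (F c) ≠ bit i c := by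
    intro c hc
    by_contra h
    push Not at h
    refine hc (Prod.ext (funext fun i => h (Sum.inl i)) (funext fun i => h (Sum.inr i)))
  have hne : Nonempty (Fin n ⊕ Fin n) := ⟨Sum.inl ⟨0, hn⟩⟩
  have h2 : ∀ c, ∃ i, F c ≠ c → bit i (F c) ≠ bit i c := by
    intro c
    by_cases h : F c ≠ c
    · obtain ⟨i, hi⟩ := hsep c h; exact ⟨i, fun _ => hi⟩
    · exact ⟨hne.some, fun h' => absurd h' h⟩
  choose idx hidx using h2
  refine ⟨fun c => (idx c, bit (idx c) c), fun c hc heq => ?_⟩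
  simp only [Prod.mk.injEq] at heq
  apply hidx c hc
  rw [← heq.2, heq.1]

lemma nm_num (n q : ℕ) (hq : 12 ≤ q) (h1 : 16 * q ≤ n) (h2 : n < 16 * (q + 1)) :
    16 * n ≤ 2 ^ q := by
  have : ∀ r : ℕ, 12 ≤ r → 256 * (r + 1) ≤ 2 ^ r := by
    intro r hr
    induction r, hr using Nat.le_induction with
    | base => norm_num
    | succ r hr ih => rw [pow_succ]; omega
  have := this q hq
  omega

lemma nm_big (n q : ℕ) (hq : 12 ≤ q) (h1 : 16 * q ≤ n) (hnum : 16 * n ≤ 2 ^ q) :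
    (Fintype.card (((BS n → BS n) × (BS n → BS n)) × BS q × BS q ×
      ((Fin n ⊕ Fin n) × Bool) × Bool) : ℝ) *
      Real.exp (- (((2 ^ (4 * q) : ℝ)⁻¹) ^ 2 * (Fintype.card (BS n × BS n) : ℝ) / 4)) < 1 := by
  have hc : Fintype.card (((BS n → BS n) × (BS n → BS n)) × BS q × BS q ×
      ((Fin n ⊕ Fin n) × Bool) × Bool) =
      ((2 ^ n) ^ (2 ^ n) * (2 ^ n) ^ (2 ^ n)) * (2 ^ q * (2 ^ q * (((n + n) * 2) * 2))) := by
    simp only [Fintype.card_prod, Fintype.card_fun, Fintype.card_sum, Fintype.card_fin,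
      Fintype.card_bool]
  have hN : 1 ≤ 2 ^ n := Nat.one_le_two_pow
  have hle : Fintype.card (((BS n → BS n) × (BS n → BS n)) × BS q × BS q ×
      ((Fin n ⊕ Fin n) × Bool) × Bool) ≤ 2 ^ (3 * (n * 2 ^ n)) := by
    rw [hc]
    have h8 : ((n + n) * 2) * 2 ≤ 2 ^ q := by omega
    calc _ ≤ ((2 ^ n) ^ (2 ^ n) * (2 ^ n) ^ (2 ^ n)) * (2 ^ q * (2 ^ q * 2 ^ q)) := by gcongr
      _ = 2 ^ (2 * (n * 2 ^ n) + 3 * q) := by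
          rw [← pow_mul]; ring
      _ ≤ _ := by
          apply Nat.pow_le_pow_right (by norm_num)
          have : n * 1 ≤ n * 2 ^ n := Nat.mul_le_mul_left _ hN
          omega
  have hle' : (Fintype.card (((BS n → BS n) × (BS n → BS n)) × BS q × BS q ×
      ((Fin n ⊕ Fin n) × Bool) × Bool) : ℝ) ≤ Real.exp (3 * (n * 2 ^ n)) := by
    calc _ ≤ (2:ℝ) ^ (3 * (n * 2 ^ n)) := by exact_mod_cast hle
      _ ≤ (Real.exp 1) ^ (3 * (n * 2 ^ n)) := by
          gcongr
          have := Real.add_one_le_exp 1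
          linarith
      _ = _ := by
          rw [← Real.exp_nat_mul]; push_cast; rw [mul_one]
  have hcV : (Fintype.card (BS n × BS n) : ℝ) = 2 ^ n * 2 ^ n := by simp
  have hX : 16 * (n * 2 ^ n : ℝ) ≤
      ((2 ^ (4 * q) : ℝ)⁻¹) ^ 2 * (Fintype.card (BS n × BS n) : ℝ) / 4 := by
    rw [hcV]
    have e1 : ((2 ^ (4 * q) : ℝ)⁻¹) ^ 2 * (2 ^ n * 2 ^ n) / 4 =
        2 ^ n * (2 ^ n / (2 ^ (8 * q) * 4)) := by
      rw [inv_pow, ← pow_mul, show 4 * q * 2 = 8 * q by ring]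
      field_simp
    have e2 : (2:ℝ) ^ q ≤ 2 ^ n / (2 ^ (8 * q) * 4) := by
      rw [le_div_iff₀ (by positivity)]
      calc (2:ℝ) ^ q * (2 ^ (8 * q) * 4) = 2 ^ (q + 8 * q + 2) := by ring
        _ ≤ 2 ^ n := pow_le_pow_right₀ (by norm_num) (by omega)
    have e3 : (16 * n : ℝ) ≤ 2 ^ q := by exact_mod_cast hnum
    rw [e1]
    calc 16 * (n * 2 ^ n : ℝ) = 2 ^ n * (16 * n) := by ring
      _ ≤ _ := by
        gcongr
        exact e3.trans e2
  have hn : (0:ℝ) < n * 2 ^ n := by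
    have : (0:ℝ) < n := by
      have : 0 < n := by omega
      exact_mod_cast this
    positivity
  calc _ ≤ Real.exp (3 * (n * 2 ^ n)) * Real.exp (-(16 * (n * 2 ^ n : ℝ))) := by gcongr
    _ < 1 := by
      rw [← Real.exp_add, Real.exp_lt_one_iff]
      linarith

lemma nm_main (n q : ℕ) (hq : 12 ≤ q) (h1 : 16 * q ≤ n) (h2 : n < 16 * (q + 1)) :
    ∃ (Enc : BS q → BS n × BS n → ℝ) (Dec : BS n × BS n → BS q),
      IsNMCode Enc Dec ((2 ^ q : ℝ)⁻¹) := by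
  classical
  have hn : 0 < n := by omega
  have hnum := nm_num n q hq h1 h2
  have hbig := nm_big n q hq h1 hnum
  let F : (BS n → BS n) × (BS n → BS n) → BS n × BS n → BS n × BS n :=
    fun φ c => (φ.1 c.1, φ.2 c.2)
  choose col hcol using fun φ => nm_col hn (F φ)
  obtain ⟨D, hD⟩ := nm_exists (M := BS q) F col hcol ((2 ^ (4 * q) : ℝ)⁻¹) (by positivity)
    (inv_le_one_of_one_le₀ (one_le_pow₀ (by norm_num))) hbig
  set e : ℝ := (Fintype.card ((Fin n ⊕ Fin n) × Bool) : ℝ) *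
    ((2 ^ (4 * q) : ℝ)⁻¹ * (Fintype.card (BS n × BS n) : ℝ)) with he
  have hm0 : (0:ℝ) < (Fintype.card (BS n × BS n) : ℝ) := by exact_mod_cast Fintype.card_pos
  have he' : e = 4 * n * (2 ^ (4 * q) : ℝ)⁻¹ * (Fintype.card (BS n × BS n) : ℝ) := by
    have : (Fintype.card ((Fin n ⊕ Fin n) × Bool) : ℝ) = 4 * n := by
      simp; ring
    rw [he, this]; ring
  have hK : (Fintype.card (BS q) : ℝ) = 2 ^ q := by simp
  have hnum' : (16 * n : ℝ) ≤ 2 ^ q := by exact_mod_cast hnum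
  have hkey : 4 * (Fintype.card (BS q) : ℝ) ^ 2 * e ≤
      (2 ^ q : ℝ)⁻¹ * (Fintype.card (BS n × BS n) : ℝ) := by
    rw [he', hK]
    have : 4 * ((2:ℝ) ^ q) ^ 2 * (4 * n * (2 ^ (4 * q) : ℝ)⁻¹ * (Fintype.card (BS n × BS n) : ℝ)) =
      (16 * n) * (((2:ℝ) ^ q) ^ 2 * (2 ^ (4 * q) : ℝ)⁻¹ * (Fintype.card (BS n × BS n) : ℝ)) := by
      ring
    rw [this]
    calc _ ≤ (2:ℝ) ^ q * (((2:ℝ) ^ q) ^ 2 * (2 ^ (4 * q) : ℝ)⁻¹ *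
          (Fintype.card (BS n × BS n) : ℝ)) := by gcongr
      _ = _ := by
        rw [show (2:ℝ) ^ (4 * q) = (2 ^ q) ^ 4 by rw [← pow_mul]; ring]
        field_simp
  have hq1 : (2 ^ q : ℝ)⁻¹ ≤ 1 := inv_le_one_of_one_le₀ (one_le_pow₀ (by norm_num))
  have he0 : 0 ≤ e := by rw [he]; positivity
  have hs : 2 * (Fintype.card (BS q) : ℝ) ^ 2 * e ≤ (Fintype.card (BS n × BS n) : ℝ) := by
    have : (2 ^ q : ℝ)⁻¹ * (Fintype.card (BS n × BS n) : ℝ) ≤ Fintype.card (BS n × BS n) :=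
      mul_le_of_le_one_left hm0.le hq1
    have : 0 ≤ (Fintype.card (BS q) : ℝ) ^ 2 * e := by positivity
    linarith
  -- size of the preimages, from the tampering function that flips the left half
  have hsize : ∀ x, |∑ c : BS n × BS n, (if D c = x then (1:ℝ) else 0) -
      (Fintype.card (BS n × BS n) : ℝ) / (Fintype.card (BS q) : ℝ)| ≤
      (Fintype.card (BS q) : ℝ) * e := by
    intro x
    let φ : (BS n → BS n) × (BS n → BS n) := (fun L i => !(L i), id)
    have hφ : ∀ c, F φ c ≠ c := by
      intro c hc
      have := congrFun (congrArg Prod.fst hc) ⟨0, hn⟩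
      simp [F, φ] at this
    have hsum : ∑ c : BS n × BS n, (if D c = x then (1:ℝ) else 0) -
      (Fintype.card (BS n × BS n) : ℝ) / (Fintype.card (BS q) : ℝ) =
      ∑ y, ∑ c : BS n × BS n, (if F φ c ≠ c ∧ D (F φ c) = y then
      ((if D c = x then (1:ℝ) else 0) - 1 / (Fintype.card (BS q) : ℝ)) else 0) := by
      rw [Finset.sum_comm]
      simp only [hφ, ne_eq, not_false_eq_true, true_and, Finset.sum_ite_eq, Finset.mem_univ,
        if_true]
      rw [Finset.sum_sub_distrib, Finset.sum_const, nsmul_eq_mul, Finset.card_univ, mul_one_div]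
    rw [hsum]
    calc _ ≤ ∑ y : BS q, e :=
          (Finset.abs_sum_le_sum_abs _ _).trans (Finset.sum_le_sum fun y _ => hD φ x y)
      _ = _ := by rw [Finset.sum_const, nsmul_eq_mul, Finset.card_univ]
  refine ⟨fun x c => if D c = x then 1 / ∑ c : BS n × BS n, (if D c = x then (1:ℝ) else 0) else 0,
    D, ?_, ?_, ?_⟩
  · intro x
    have hpos : 0 < ∑ c : BS n × BS n, (if D c = x then (1:ℝ) else 0) := by
      have h3 := (abs_le.mp (hsize x)).1
      have hK0 : (0:ℝ) < (Fintype.card (BS q) : ℝ) := by rw [hK]; positivity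
      have h4 : (Fintype.card (BS q) : ℝ) * e <
          (Fintype.card (BS n × BS n) : ℝ) / (Fintype.card (BS q) : ℝ) := by
        rw [lt_div_iff₀ hK0]
        nlinarith
      linarith
    refine ⟨fun c => ?_, ?_⟩
    · dsimp only
      split_ifs
      · positivity
      · exact le_rfl
    · have : ∀ c : BS n × BS n, (if D c = x then
          1 / ∑ c : BS n × BS n, (if D c = x then (1:ℝ) else 0) else 0) =
          (if D c = x then (1:ℝ) else 0) / ∑ c : BS n × BS n, (if D c = x then (1:ℝ) else 0) := by
        intro c; split_ifs <;> simp
      simp only [this]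
      rw [← Finset.sum_div, div_self hpos.ne']
  · intro x c hc
    by_contra h
    simp [h] at hc
  · intro f g
    obtain ⟨G, hG, hGs⟩ := nm_sd D (F (f, g)) e (hD (f, g)) hsize hs
    refine ⟨G, hG, fun x => ?_⟩
    have := hGs x
    refine le_trans (le_of_eq ?_) (this.trans ?_)
    · congr 
    · rw [div_le_iff₀ hm0]; exact hkey

theorem stmt7 :
    ∃ (c c' : ℝ) (n0 : ℕ), 0 < c ∧ 0 < c' ∧
      ∀ n : ℕ, n0 ≤ n →
        ∃ (k : ℕ) (Enc : BS k → BS n × BS n → ℝ) (Dec : BS n × BS n → BS k),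
          c * n * log2 (log2 n) / log2 n ≤ (k : ℝ) ∧
          IsNMCode Enc Dec ((2 : ℝ) ^ (-(c' * n * log2 (log2 n) / log2 n))) := by
  refine ⟨1 / 32, 1 / 32, 192, by norm_num, by norm_num, fun n hn => ?_⟩
  have hq : 12 ≤ n / 16 := by omega
  obtain ⟨Enc, Dec, h⟩ := nm_main n (n / 16) hq (by omega) (by omega)
  have hL : 0 < log2 n := by
    unfold log2
    apply Real.logb_pos (by norm_num)
    have : 1 < n := by omega
    exact_mod_cast this
  have hLL : log2 (log2 n) ≤ log2 n := by
    generalize log2 n = z at hL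
    unfold log2
    rw [Real.logb_le_iff_le_rpow (by norm_num) hL]
    have h1 := one_add_mul_self_le_rpow_one_add (s := 1) (by norm_num) (p := max z 1) (le_max_right _ _)
    rcases le_total z 1 with hz | hz
    · exact hz.trans (Real.one_le_rpow (by norm_num) hL.le)
    · rw [max_eq_left hz] at h1
      norm_num at h1
      linarith
  have hr : 1 / 32 * (n:ℝ) * log2 (log2 n) / log2 n ≤ ((n / 16 : ℕ) : ℝ) := by
    have h3 : (n:ℝ) ≤ 32 * ((n / 16 : ℕ) : ℝ) := by
      have : n ≤ 32 * (n / 16) := by omega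
      exact_mod_cast this
    rw [div_le_iff₀ hL]
    calc 1 / 32 * (n:ℝ) * log2 (log2 n) ≤ 1 / 32 * (n:ℝ) * log2 n := by gcongr
      _ ≤ _ := by
        gcongr
        linarith
  refine ⟨n / 16, Enc, Dec, hr, h.1, h.2.1, fun f g => ?_⟩
  obtain ⟨G, hG, hGs⟩ := h.2.2 f g
  refine ⟨G, hG, fun x => (hGs x).trans ?_⟩
  rw [← Real.rpow_natCast, ← Real.rpow_neg (by norm_num)]
  exact Real.rpow_le_rpow_of_exponent_le (by norm_num) (neg_le_neg hr)
end
end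

section
/- There exist constants C > 1, c1 > 0 and α > 0 such that for every integer a ≥ 2, all integers n ≥ 16 and k, and every 0 < ε < 2^{-16} with k ≥ C·(log n + a·log(1/ε)), there exists a strong seeded (k,ε) non-malleable extractor snmExt : {0,1}^n × {0,1}^d → {0,1}^m with seed length d ≤ c1·log n + log(1/ε)·2^{c1·a·(log log(1/ε))^{1/a}} and output length m ≥ α·k. Moreover, under the alternative parameter setting k ≥ C·log n + log(1/ε)·2^{C·a·(log log(1/ε))^{1/a}}, there exists such an extractor with seed length d ≤ c1·(log n + a·log(1/ε)) and m ≥ α·k. -/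
noncomputable section

/-- `ext` is a strong seeded `(k, ε)` non-malleable extractor: for every source `X` on
`{0,1}^n` with min-entropy at least `k`, every fixed-point-free tampering `A` of the seed,
and `Y` uniform on `{0,1}^d` independent of `X`, the joint distribution of
`(ext(X,Y), ext(X,A(Y)), Y)` is `ε`-close to `(U_m, ext(X,A(Y)), Y)`. -/
def IsStrongSNME {n d m : ℕ} (ext : BS n → BS d → BS m) (k ε : ℝ) : Prop :=
  ∀ X : BS n → ℝ, IsDist X → minEntropyGe X k →
    ∀ A : BS d → BS d, (∀ s, A s ≠ s) →
      sd (distMap (fun p : BS n × BS d => (ext p.1 p.2, ext p.1 (A p.2), p.2))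
            (prodDist X (unifDist (BS d))))
         (distMap (fun p : BS m × BS n × BS d => (p.1, ext p.2.1 (A p.2.2), p.2.2))
            (prodDist (unifDist (BS m)) (prodDist X (unifDist (BS d))))) ≤ ε

/-- Resampling one coordinate. -/
lemma resample {Y R : Type*} [Fintype Y] [DecidableEq Y] [Fintype R]
    (y : Y) (G : (Y → R) → ℝ) :
    (Fintype.card R : ℝ) * ∑ r : Y → R, G r
      = ∑ r : Y → R, ∑ u : R, G (Function.update r y u) := by
  classical
  have e := (Equiv.funSplitAt y R)
  have h1 : ∀ H : (Y → R) → ℝ, ∑ r : Y → R, H r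
      = ∑ p : R × ({j // j ≠ y} → R), H ((Equiv.funSplitAt y R).symm p) := by
    intro H
    exact (Equiv.sum_comp (Equiv.funSplitAt y R).symm H).symm
  have h2 : ∀ (p : R × ({j // j ≠ y} → R)) (u : R),
      Function.update ((Equiv.funSplitAt y R).symm p) y u
        = (Equiv.funSplitAt y R).symm (u, p.2) := by
    intro p u
    ext j
    by_cases hj : j = y
    · subst hj; simp [Equiv.funSplitAt, Equiv.piSplitAt]
    · simp [Equiv.funSplitAt, Equiv.piSplitAt, hj]
  rw [h1 G, h1 (fun r => ∑ u : R, G (Function.update r y u))]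
  simp only [h2]
  rw [Fintype.sum_prod_type, Fintype.sum_prod_type]
  simp only [Finset.sum_const, Finset.card_univ, nsmul_eq_mul]
  congr 1
  rw [Finset.sum_comm]

/-- Moment generating function bound for bounded centred sums. -/
lemma mgf_step {R : Type*} [Fintype R] (t : R → ℝ) (b : ℝ) (hb : b ≤ 1)
    (h0 : ∑ u, t u = 0) (ht : ∀ u, |t u| ≤ b) :
    ∑ u, Real.exp (t u) ≤ (Fintype.card R : ℝ) * Real.exp (b ^ 2) := by
  have h1 : ∀ u, Real.exp (t u) ≤ 1 + t u + b ^ 2 := by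
    intro u
    have h := Real.abs_exp_sub_one_sub_id_le ((ht u).trans hb)
    have h2 : t u ^ 2 ≤ b ^ 2 := by
      rw [← sq_abs (t u)]
      exact pow_le_pow_left₀ (abs_nonneg _) (ht u) 2
    have := (abs_le.1 h).2
    linarith
  calc ∑ u, Real.exp (t u) ≤ ∑ u, (1 + t u + b ^ 2) := Finset.sum_le_sum fun u _ => h1 u
    _ = (Fintype.card R : ℝ) * (b ^ 2 + 1) := by
      simp only [Finset.sum_add_distrib, h0]
      simp
      ring
    _ ≤ _ := by
      gcongr
      exact Real.add_one_le_exp _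

/-- Exponential moment of a martingale-like sum along an ordering. -/
lemma mgf_ordered {Y R : Type*} [Fintype Y] [DecidableEq Y] [Fintype R] [Nonempty R]
    (key : Y → ℤ) (A : Y → Y) (φ : Y → R → R → ℝ) (b : ℝ) (hb : b ≤ 1)
    (h0 : ∀ y w, ∑ u, φ y u w = 0) (hφ : ∀ y u w, |φ y u w| ≤ b)
    (hinj : Function.Injective key)
    (S : Finset Y) :
    (∀ y ∈ S, key (A y) < key y) →
    ∑ r : Y → R, Real.exp (∑ y ∈ S, φ y (r y) (r (A y)))
      ≤ (Fintype.card (Y → R) : ℝ) * Real.exp (b ^ 2 * S.card) := by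
  induction S using Finset.induction_on_max_value key with
  | empty => intro _; simp
  | insert a s ha hmax ih =>
    intro hS
    have ih' := ih (fun y hy => hS y (Finset.mem_insert_of_mem hy))
    have hlt : ∀ y ∈ s, key y < key a := fun y hy =>
      lt_of_le_of_ne (hmax y hy) (fun h => ha (hinj h ▸ hy))
    have hAa : A a ≠ a := fun h => by
      have := hS a (Finset.mem_insert_self _ _)
      rw [h] at this
      exact lt_irrefl _ this
    have hy1 : ∀ y ∈ s, y ≠ a := fun y hy h => ha (h ▸ hy)
    have hy2 : ∀ y ∈ s, A y ≠ a := fun y hy h => by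
      have h1 := hS y (Finset.mem_insert_of_mem hy)
      have h2 := hlt y hy
      rw [h] at h1
      exact lt_asymm h1 h2
    have hR : (0 : ℝ) < Fintype.card R := by exact_mod_cast Fintype.card_pos
    have key1 := resample (R := R) a
      (fun r => Real.exp (∑ y ∈ insert a s, φ y (r y) (r (A y))))
    have key2 : ∀ (r : Y → R) (u : R),
        Real.exp (∑ y ∈ insert a s,
          φ y (Function.update r a u y) (Function.update r a u (A y)))
        = Real.exp (φ a u (r (A a))) * Real.exp (∑ y ∈ s, φ y (r y) (r (A y))) := by
      intro r u
      rw [Finset.sum_insert ha, Real.exp_add]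
      congr 2
      · simp [Function.update_of_ne hAa]
      · refine Finset.sum_congr rfl fun y hy => ?_
        rw [Function.update_of_ne (hy1 y hy), Function.update_of_ne (hy2 y hy)]
    simp only [key2] at key1
    have key3 : ∑ r : Y → R, ∑ u : R,
        Real.exp (φ a u (r (A a))) * Real.exp (∑ y ∈ s, φ y (r y) (r (A y)))
        ≤ ∑ r : Y → R, (Fintype.card R : ℝ) * Real.exp (b ^ 2)
            * Real.exp (∑ y ∈ s, φ y (r y) (r (A y))) := by
      refine Finset.sum_le_sum fun r _ => ?_
      rw [← Finset.sum_mul]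
      gcongr
      exact mgf_step (fun u => φ a u (r (A a))) b hb (h0 a _) (fun u => hφ a u _)
    rw [← Finset.mul_sum, ← key1, mul_assoc] at key3
    have key4 := le_of_mul_le_mul_left key3 hR
    refine key4.trans ?_
    rw [Finset.card_insert_of_notMem ha]
    push_cast
    rw [mul_add, mul_one, Real.exp_add]
    calc _ ≤ Real.exp (b ^ 2) * ((Fintype.card (Y → R) : ℝ) * Real.exp (b ^ 2 * s.card)) := by
          gcongr
      _ = _ := by ring

/-- Exponential moment bound for a fixed-point-free `A`. -/
lemma mgf_full {Y R : Type*} [Fintype Y] [DecidableEq Y] [Fintype R] [Nonempty R]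
    (A : Y → Y) (hA : ∀ y, A y ≠ y) (φ : Y → R → R → ℝ) (μ : ℝ) (hμ0 : 0 ≤ μ) (hμ : μ ≤ 1 / 4)
    (h0 : ∀ y w, ∑ u, φ y u w = 0) (hφ : ∀ y u w, |φ y u w| ≤ 2) :
    ∑ r : Y → R, Real.exp (μ * ∑ y, φ y (r y) (r (A y)))
      ≤ (Fintype.card (Y → R) : ℝ) * Real.exp (16 * μ ^ 2 * Fintype.card Y) := by
  classical
  let key : Y → ℤ := fun y => ((Fintype.equivFin Y y : ℕ) : ℤ)
  have hinj : Function.Injective key := by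
    intro x y h
    simpa [key, Fin.val_inj] using h
  let S1 := Finset.univ.filter (fun y => key (A y) < key y)
  let S2 := Finset.univ.filter (fun y => ¬ key (A y) < key y)
  let ψ : Y → R → R → ℝ := fun y u w => 2 * μ * φ y u w
  have hψ0 : ∀ y w, ∑ u, ψ y u w = 0 := by
    intro y w
    simp only [ψ]
    rw [← Finset.mul_sum, h0, mul_zero]
  have hψ : ∀ y u w, |ψ y u w| ≤ 4 * μ := by
    intro y u w
    simp only [ψ]
    rw [abs_mul, abs_of_nonneg (by positivity)]
    nlinarith [hφ y u w]
  have hb : 4 * μ ≤ 1 := by linarith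
  have m1 := mgf_ordered key A ψ (4 * μ) hb hψ0 hψ hinj S1 (by simp [S1])
  have m2 := mgf_ordered (fun y => - key y) A ψ (4 * μ) hb hψ0 hψ
    (fun x y h => hinj (neg_injective h)) S2 (by
      intro y hy
      simp only [S2, Finset.mem_filter, Finset.mem_univ, true_and, not_lt] at hy
      have : key (A y) ≠ key y := fun h => hA y (hinj h)
      have := lt_of_le_of_ne hy this.symm
      simpa using this)
  have hc : ∀ S : Finset Y, (Fintype.card (Y → R) : ℝ) * Real.exp ((4 * μ) ^ 2 * S.card)
      ≤ (Fintype.card (Y → R) : ℝ) * Real.exp (16 * μ ^ 2 * Fintype.card Y) := by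
    intro S
    have : (S.card : ℝ) ≤ Fintype.card Y := by exact_mod_cast Finset.card_le_univ S
    gcongr
    nlinarith
  have hp : ∀ r : Y → R, Real.exp (μ * ∑ y, φ y (r y) (r (A y)))
      ≤ (Real.exp (∑ y ∈ S1, ψ y (r y) (r (A y)))
        + Real.exp (∑ y ∈ S2, ψ y (r y) (r (A y)))) / 2 := by
    intro r
    have hs : ∑ y, φ y (r y) (r (A y)) = ∑ y ∈ S1, φ y (r y) (r (A y))
        + ∑ y ∈ S2, φ y (r y) (r (A y)) :=
      (Finset.sum_filter_add_sum_filter_not _ _ _).symm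
    rw [hs]
    simp only [ψ]
    rw [← Finset.mul_sum, ← Finset.mul_sum]
    set p := ∑ y ∈ S1, φ y (r y) (r (A y))
    set q := ∑ y ∈ S2, φ y (r y) (r (A y))
    have e1 : Real.exp (2 * μ * p) = Real.exp (μ * p) ^ 2 := by
      rw [← Real.exp_nat_mul]; congr 1; push_cast; ring
    have e2 : Real.exp (2 * μ * q) = Real.exp (μ * q) ^ 2 := by
      rw [← Real.exp_nat_mul]; congr 1; push_cast; ring
    rw [mul_add, Real.exp_add, e1, e2]
    nlinarith [sq_nonneg (Real.exp (μ * p) - Real.exp (μ * q))]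
  calc _ ≤ ∑ r : Y → R, (Real.exp (∑ y ∈ S1, ψ y (r y) (r (A y)))
        + Real.exp (∑ y ∈ S2, ψ y (r y) (r (A y)))) / 2 := Finset.sum_le_sum fun r _ => hp r
    _ = (∑ r : Y → R, Real.exp (∑ y ∈ S1, ψ y (r y) (r (A y)))
        + ∑ r : Y → R, Real.exp (∑ y ∈ S2, ψ y (r y) (r (A y)))) / 2 := by
      rw [← Finset.sum_div, Finset.sum_add_distrib]
    _ ≤ _ := by linarith [hc S1, hc S2]

/-- Sign of a bit. -/
def sgnB (b : Bool) : ℝ := if b then 1 else -1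

lemma abs_sgnB (b : Bool) : |sgnB b| = 1 := by cases b <;> simp [sgnB]

/-- The centred test. -/
def cTest {Y R : Type*} [Fintype R] (f : Y → R → R → Bool) (y : Y) (u w : R) : ℝ :=
  sgnB (f y u w) - (1 / (Fintype.card R : ℝ)) * ∑ v, sgnB (f y v w)

lemma cTest_sum {Y R : Type*} [Fintype R] [Nonempty R] (f : Y → R → R → Bool) (y : Y) (w : R) :
    ∑ u, cTest f y u w = 0 := by
  have hR : (Fintype.card R : ℝ) ≠ 0 := by exact_mod_cast Fintype.card_ne_zero
  simp only [cTest, Finset.sum_sub_distrib, Finset.sum_const, Finset.card_univ, nsmul_eq_mul]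
  field_simp
  ring

lemma cTest_abs {Y R : Type*} [Fintype R] [Nonempty R] (f : Y → R → R → Bool) (y : Y) (u w : R) :
    |cTest f y u w| ≤ 2 := by
  have hR : (0 : ℝ) < Fintype.card R := by exact_mod_cast Fintype.card_pos
  have h1 : |∑ v, sgnB (f y v w)| ≤ (Fintype.card R : ℝ) := by
    refine (Finset.abs_sum_le_sum_abs _ _).trans ?_
    simp [abs_sgnB]
  have h2 : |(1 / (Fintype.card R : ℝ)) * ∑ v, sgnB (f y v w)| ≤ 1 := by
    rw [abs_mul, abs_of_nonneg (by positivity), one_div, inv_mul_le_iff₀ hR, mul_one]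
    exact h1
  have h3 := abs_sub (sgnB (f y u w)) ((1 / (Fintype.card R : ℝ)) * ∑ v, sgnB (f y v w))
  rw [abs_sgnB] at h3
  unfold cTest
  linarith

/-- Total score of a row against a tampering and a test. -/
def score {Y R : Type*} [Fintype Y] [Fintype R] (A : Y → Y) (f : Y → R → R → Bool)
    (r : Y → R) : ℝ := ∑ y, cTest f y (r y) (r (A y))

/-- Truncated exponential moment. -/
lemma trunc_moment {Y R : Type*} [Fintype Y] [DecidableEq Y] [Fintype R] [Nonempty R]
    (A : Y → Y) (hA : ∀ y, A y ≠ y) (f : Y → R → R → Bool) (ε N : ℝ)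
    (hε : 0 < ε) (hε1 : ε ≤ 1) (hN : 0 < N)
    (hD : Real.log N ≤ ε ^ 2 * Fintype.card Y / 64) :
    ∑ r : Y → R, Real.exp (ε / 32 * max (score A f r - ε * Fintype.card Y) 0)
      ≤ (Fintype.card (Y → R) : ℝ) * (1 + 1 / N) := by
  set D : ℝ := ((Fintype.card Y : ℕ) : ℝ) with hDdef
  have hm := mgf_full A hA (cTest f) (ε / 32) (by positivity) (by linarith) (cTest_sum f)
    (cTest_abs f)
  have h1 : ∀ r : Y → R, Real.exp (ε / 32 * max (score A f r - ε * D) 0)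
      ≤ 1 + Real.exp (-(ε / 32 * (ε * D))) * Real.exp (ε / 32 * score A f r) := by
    intro r
    rw [← Real.exp_add]
    rcases max_cases (score A f r - ε * D) 0 with ⟨h, _⟩ | ⟨h, _⟩
    · rw [h]
      have : ε / 32 * (score A f r - ε * D) = -(ε / 32 * (ε * D)) + ε / 32 * score A f r := by
        ring
      rw [this]
      linarith
    · rw [h, mul_zero, Real.exp_zero]
      linarith [Real.exp_pos (-(ε / 32 * (ε * D)) + ε / 32 * score A f r)]
  calc _ ≤ ∑ r : Y → R, (1 + Real.exp (-(ε / 32 * (ε * D))) * Real.exp (ε / 32 * score A f r)) :=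
        Finset.sum_le_sum fun r _ => h1 r
    _ = (Fintype.card (Y → R) : ℝ) + Real.exp (-(ε / 32 * (ε * D)))
          * ∑ r : Y → R, Real.exp (ε / 32 * score A f r) := by
        rw [Finset.sum_add_distrib, ← Finset.mul_sum]
        simp
    _ ≤ (Fintype.card (Y → R) : ℝ) + Real.exp (-(ε / 32 * (ε * D)))
          * ((Fintype.card (Y → R) : ℝ) * Real.exp (16 * (ε / 32) ^ 2 * D)) := by
        gcongr
        exact hm
    _ = (Fintype.card (Y → R) : ℝ) * (1 + Real.exp (-(ε ^ 2 * D / 64))) := by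
        have : Real.exp (-(ε ^ 2 * D / 64))
            = Real.exp (-(ε / 32 * (ε * D))) * Real.exp (16 * (ε / 32) ^ 2 * D) := by
          rw [← Real.exp_add]; congr 1; ring
        rw [this]; ring
    _ ≤ _ := by
        gcongr
        rw [Real.exp_neg, one_div]
        gcongr
        exact (Real.log_le_iff_le_exp hN).1 hD

/-- Existence of a good function by the probabilistic method. -/
lemma exists_good_s8 {Q Y R : Type*} [Fintype Q] [DecidableEq Q] [Nonempty Q]
    [Fintype Y] [DecidableEq Y] [Fintype R]
    [DecidableEq R] [Nonempty R] (ε K : ℝ) (hε : 0 < ε) (hε1 : ε ≤ 1)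
    (hD : Real.log (Fintype.card Q) ≤ ε ^ 2 * Fintype.card Y / 64)
    (hK : (Fintype.card ((Y → Y) × (Y → R → R → Bool)) : ℝ)
      < Real.exp (ε ^ 2 * Fintype.card Y * K / 32 - 1)) :
    ∃ ext : Q → Y → R, ∀ A : Y → Y, (∀ y, A y ≠ y) → ∀ f : Y → R → R → Bool,
      ∑ x, max (score A f (ext x) - ε * Fintype.card Y) 0 ≤ ε * Fintype.card Y * K := by
  classical
  by_contra hcon
  push Not at hcon
  set D : ℝ := ((Fintype.card Y : ℕ) : ℝ) with hDdef
  let T := (Y → Y) × (Y → R → R → Bool)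
  let G : Finset T := Finset.univ.filter (fun p => ∀ y, p.1 y ≠ y)
  let Z : T → (Q → Y → R) → ℝ := fun p ext =>
    ∑ x, max (score p.1 p.2 (ext x) - ε * D) 0
  have hN : (0 : ℝ) < Fintype.card Q := by exact_mod_cast Fintype.card_pos
  have hone : ∀ ext : Q → Y → R,
      1 ≤ ∑ p ∈ G, Real.exp (-(ε / 32 * (ε * D * K))) * Real.exp (ε / 32 * Z p ext) := by
    intro ext
    obtain ⟨A, hA, f, hf⟩ := hcon ext
    have hmem : ((A, f) : T) ∈ G := by simp [G, hA]
    refine le_trans ?_ (Finset.single_le_sum (f := fun p => Real.exp (-(ε / 32 * (ε * D * K)))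
      * Real.exp (ε / 32 * Z p ext)) (fun p _ => by positivity) hmem)
    rw [← Real.exp_add]
    apply Real.one_le_exp
    have : ε / 32 * (ε * D * K) ≤ ε / 32 * Z (A, f) ext := by
      gcongr
    linarith
  have hprod : ∀ p ∈ G, ∑ ext : Q → Y → R, Real.exp (ε / 32 * Z p ext)
      ≤ (Fintype.card (Q → Y → R) : ℝ) * Real.exp 1 := by
    intro p hp
    have hp' : ∀ y, p.1 y ≠ y := by simpa [G] using hp
    have e1 : ∀ ext : Q → Y → R, Real.exp (ε / 32 * Z p ext)
        = ∏ x, Real.exp (ε / 32 * max (score p.1 p.2 (ext x) - ε * D) 0) := by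
      intro ext
      rw [← Real.exp_sum, ← Finset.mul_sum]
    simp only [e1]
    have e2 := Finset.prod_univ_sum (fun _ : Q => (Finset.univ : Finset (Y → R)))
      (fun _ r => Real.exp (ε / 32 * max (score p.1 p.2 r - ε * D) 0))
    rw [Fintype.piFinset_univ] at e2
    rw [← e2]
    have hm := trunc_moment p.1 hp' p.2 ε (Fintype.card Q) hε hε1 hN hD
    rw [Finset.prod_const, Finset.card_univ]
    calc _ ≤ ((Fintype.card (Y → R) : ℝ) * (1 + 1 / (Fintype.card Q : ℝ))) ^ Fintype.card Q := by
          gcongr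
      _ = (Fintype.card (Q → Y → R) : ℝ) * (1 + 1 / (Fintype.card Q : ℝ)) ^ Fintype.card Q := by
          rw [mul_pow, Fintype.card_fun (α := Q)]
          push_cast
          rfl
      _ ≤ _ := by
          gcongr
          calc (1 + 1 / (Fintype.card Q : ℝ)) ^ Fintype.card Q
              ≤ (Real.exp (1 / (Fintype.card Q : ℝ))) ^ Fintype.card Q := by
                gcongr
                linarith [Real.add_one_le_exp (1 / (Fintype.card Q : ℝ))]
            _ = Real.exp 1 := by
                rw [← Real.exp_nat_mul]
                congr 1
                field_simp
  have hE : (0 : ℝ) < Fintype.card (Q → Y → R) := by exact_mod_cast Fintype.card_pos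
  have hfinal : (Fintype.card (Q → Y → R) : ℝ)
      ≤ (Fintype.card T : ℝ) * (Real.exp (-(ε / 32 * (ε * D * K)))
        * ((Fintype.card (Q → Y → R) : ℝ) * Real.exp 1)) := by
    calc (Fintype.card (Q → Y → R) : ℝ) = ∑ ext : Q → Y → R, (1 : ℝ) := by simp
      _ ≤ ∑ ext : Q → Y → R, ∑ p ∈ G,
          Real.exp (-(ε / 32 * (ε * D * K))) * Real.exp (ε / 32 * Z p ext) :=
          Finset.sum_le_sum fun ext _ => hone ext
      _ = ∑ p ∈ G, Real.exp (-(ε / 32 * (ε * D * K)))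
            * ∑ ext : Q → Y → R, Real.exp (ε / 32 * Z p ext) := by
          rw [Finset.sum_comm]
          simp only [Finset.mul_sum]
      _ ≤ ∑ p ∈ G, Real.exp (-(ε / 32 * (ε * D * K)))
            * ((Fintype.card (Q → Y → R) : ℝ) * Real.exp 1) := by
          refine Finset.sum_le_sum fun p hp => ?_
          gcongr
          exact hprod p hp
      _ ≤ _ := by
          rw [Finset.sum_const, nsmul_eq_mul]
          gcongr
          exact Finset.card_le_univ G
  have h3 : Real.exp (-(ε / 32 * (ε * D * K))) * ((Fintype.card (Q → Y → R) : ℝ) * Real.exp 1)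
      = (Fintype.card (Q → Y → R) : ℝ) * (Real.exp (ε ^ 2 * D * K / 32 - 1))⁻¹ := by
    rw [← Real.exp_neg]
    have : Real.exp (-(ε ^ 2 * D * K / 32 - 1))
        = Real.exp (-(ε / 32 * (ε * D * K))) * Real.exp 1 := by
      rw [← Real.exp_add]; congr 1; ring
    rw [this]; ring
  rw [h3] at hfinal
  have hx := Real.exp_pos (ε ^ 2 * D * K / 32 - 1)
  have h4 : (Fintype.card T : ℝ) * (Real.exp (ε ^ 2 * D * K / 32 - 1))⁻¹ < 1 := by
    rw [mul_inv_lt_iff₀ hx, one_mul]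
    exact hK
  nlinarith

lemma sum_distMap {α β : Type*} [Fintype α] [Fintype β] [DecidableEq β] (g : α → β) (p : α → ℝ)
    (h : β → ℝ) : ∑ b, h b * distMap g p b = ∑ a, h (g a) * p a := by
  simp only [distMap, Finset.mul_sum]
  rw [Finset.sum_comm]
  refine Finset.sum_congr rfl fun a _ => ?_
  simp

/-- The statistical distance is attained by some test. -/
lemma sd_eq_score {n d m : ℕ} (ext : BS n → BS d → BS m) (X : BS n → ℝ) (A : BS d → BS d) :
    ∃ f : BS d → BS m → BS m → Bool,
      sd (distMap (fun p : BS n × BS d => (ext p.1 p.2, ext p.1 (A p.2), p.2))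
            (prodDist X (unifDist (BS d))))
         (distMap (fun p : BS m × BS n × BS d => (p.1, ext p.2.1 (A p.2.2), p.2.2))
            (prodDist (unifDist (BS m)) (prodDist X (unifDist (BS d)))))
      = (∑ x, X x * score A f (ext x)) / (Fintype.card (BS d) : ℝ) / 2 := by
  classical
  set P := distMap (fun p : BS n × BS d => (ext p.1 p.2, ext p.1 (A p.2), p.2))
            (prodDist X (unifDist (BS d))) with hP
  set Q := distMap (fun p : BS m × BS n × BS d => (p.1, ext p.2.1 (A p.2.2), p.2.2))
            (prodDist (unifDist (BS m)) (prodDist X (unifDist (BS d)))) with hQ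
  let f : BS d → BS m → BS m → Bool := fun y z w => decide (Q (z, w, y) ≤ P (z, w, y))
  refine ⟨f, ?_⟩
  let h : BS m × BS m × BS d → ℝ := fun b => sgnB (f b.2.2 b.1 b.2.1)
  have h1 : ∀ b, |P b - Q b| = h b * P b - h b * Q b := by
    rintro ⟨z, w, y⟩
    simp only [h, f, sgnB]
    by_cases hle : Q (z, w, y) ≤ P (z, w, y)
    · rw [abs_of_nonneg (by linarith)]; simp [hle]
    · rw [abs_of_neg (by linarith)]; simp [hle]; ring
  unfold sd
  congr 1
  simp only [h1]
  rw [Finset.sum_sub_distrib, hP, hQ, sum_distMap, sum_distMap]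
  rw [Fintype.sum_prod_type, Fintype.sum_prod_type, Finset.sum_comm (s := (Finset.univ : Finset (BS m)))]
  rw [Fintype.sum_prod_type, ← Finset.sum_sub_distrib, Finset.sum_div]
  refine Finset.sum_congr rfl fun x _ => ?_
  rw [← Finset.sum_sub_distrib, score, Finset.mul_sum, Finset.sum_div]
  refine Finset.sum_congr rfl fun y _ => ?_
  simp only [h, prodDist, unifDist, cTest]
  rw [← Finset.sum_mul]
  ring

/-- From the combinatorial condition to the extractor property. -/
lemma isStrong_of_good {n d m : ℕ} (ext : BS n → BS d → BS m) (k : ℕ) (ε : ℝ) (hε : 0 < ε)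
    (hgood : ∀ A : BS d → BS d, (∀ y, A y ≠ y) → ∀ f : BS d → BS m → BS m → Bool,
      ∑ x, max (score A f (ext x) - ε * Fintype.card (BS d)) 0
        ≤ ε * Fintype.card (BS d) * (2 : ℝ) ^ k) :
    IsStrongSNME ext (k : ℝ) ε := by
  intro X hX hmin A hA
  obtain ⟨f, hf⟩ := sd_eq_score ext X A
  rw [hf]
  have hD : (0 : ℝ) < Fintype.card (BS d) := by exact_mod_cast Fintype.card_pos
  have hg := hgood A hA f
  set D : ℝ := ((Fintype.card (BS d) : ℕ) : ℝ) with hDdef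
  have hk : ∀ x, X x ≤ ((2 : ℝ) ^ k)⁻¹ := by
    intro x
    have := hmin x
    rwa [Real.rpow_neg (by norm_num), Real.rpow_natCast] at this
  have h1 : ∀ x, X x * score A f (ext x)
      ≤ X x * (ε * D) + ((2 : ℝ) ^ k)⁻¹ * max (score A f (ext x) - ε * D) 0 := by
    intro x
    have a1 : score A f (ext x) ≤ ε * D + max (score A f (ext x) - ε * D) 0 := by
      linarith [le_max_left (score A f (ext x) - ε * D) 0]
    have a2 := mul_le_mul_of_nonneg_left a1 (hX.1 x)
    have a3 := mul_le_mul_of_nonneg_right (hk x) (le_max_right (score A f (ext x) - ε * D) 0)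
    linarith
  have h2 : ∑ x, X x * score A f (ext x) ≤ 2 * (ε * D) := by
    calc _ ≤ ∑ x, (X x * (ε * D) + ((2 : ℝ) ^ k)⁻¹ * max (score A f (ext x) - ε * D) 0) :=
          Finset.sum_le_sum fun x _ => h1 x
      _ = ε * D + ((2 : ℝ) ^ k)⁻¹ * ∑ x, max (score A f (ext x) - ε * D) 0 := by
          rw [Finset.sum_add_distrib, ← Finset.sum_mul, hX.2, one_mul, ← Finset.mul_sum]
      _ ≤ ε * D + ((2 : ℝ) ^ k)⁻¹ * (ε * D * (2 : ℝ) ^ k) := by gcongr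
      _ = 2 * (ε * D) := by field_simp; ring
  rw [div_div, div_le_iff₀ (by positivity)]
  linarith

/-- Existence with explicit numeric conditions. -/
lemma exists_ext (n k d m : ℕ) (ε : ℝ) (hε : 0 < ε) (hε1 : ε ≤ 1)
    (h1 : 64 * (n : ℝ) ≤ ε ^ 2 * 2 ^ d)
    (h2 : 32 * ((d : ℝ) + 4 ^ m + 1) < ε ^ 2 * 2 ^ k) :
    ∃ ext : BS n → BS d → BS m, IsStrongSNME ext (k : ℝ) ε := by
  have cQ : ∀ j : ℕ, Fintype.card (BS j) = 2 ^ j := fun j => by simp [BS]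
  have hlog2 : Real.log 2 ≤ 1 := by linarith [Real.log_two_lt_d9]
  have h2e : (2 : ℝ) ≤ Real.exp 1 := by linarith [Real.exp_one_gt_d9]
  obtain ⟨ext, hext⟩ := exists_good_s8 (Q := BS n) (Y := BS d) (R := BS m) ε ((2 : ℝ) ^ k) hε hε1
    (by
      rw [cQ, cQ]
      push_cast
      rw [Real.log_pow, le_div_iff₀ (by norm_num)]
      have : (n : ℝ) * Real.log 2 ≤ n := mul_le_of_le_one_right (by positivity) hlog2
      linarith)
    (by
      have hc : Fintype.card ((BS d → BS d) × (BS d → BS m → BS m → Bool))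
          = 2 ^ (2 ^ d * (d + 4 ^ m)) := by
        rw [Fintype.card_prod, Fintype.card_fun (α := BS d) (β := BS d),
          Fintype.card_fun (α := BS d) (β := BS m → BS m → Bool),
          Fintype.card_fun (α := BS m) (β := BS m → Bool),
          Fintype.card_fun (α := BS m) (β := Bool),
          cQ, cQ, Fintype.card_bool, ← pow_mul, ← pow_mul, ← pow_mul, ← pow_add]
        congr 1
        rw [show (4 : ℕ) = 2 * 2 by norm_num, mul_pow]
        ring
      rw [hc, cQ]
      push_cast
      have hD1 : (1 : ℝ) ≤ 2 ^ d := one_le_pow₀ (by norm_num)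
      calc (2 : ℝ) ^ (2 ^ d * (d + 4 ^ m)) ≤ (Real.exp 1) ^ (2 ^ d * (d + 4 ^ m)) := by gcongr
        _ = Real.exp (2 ^ d * (d + 4 ^ m)) := by
          rw [← Real.exp_nat_mul]; congr 1; push_cast; ring
        _ < _ := by
          apply Real.exp_lt_exp.2
          have := mul_lt_mul_of_pos_left h2 (show (0 : ℝ) < 2 ^ d by positivity)
          nlinarith)
  exact ⟨ext, isStrong_of_good ext k ε hε hext⟩

/-- The parameters. -/
lemma main_exists (n k : ℕ) (hn : 16 ≤ n) (ε : ℝ) (hε : 0 < ε)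
    (hε2 : ε < (2 : ℝ) ^ (-(16 : ℝ)))
    (hk : 8 * (log2 n + log2 (1 / ε)) ≤ (k : ℝ)) :
    ∃ (d m : ℕ) (ext : BS n → BS d → BS m),
      (d : ℝ) ≤ 3 * (log2 n + log2 (1 / ε)) ∧ 1 / 16 * (k : ℝ) ≤ (m : ℝ) ∧
        IsStrongSNME ext (k : ℝ) ε := by
  have hn0 : (0 : ℝ) < n := by positivity
  have hL : 4 ≤ log2 n := by
    unfold log2
    rw [Real.le_logb_iff_rpow_le (by norm_num) hn0]
    have : (16 : ℝ) ≤ n := by exact_mod_cast hn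
    norm_num
    exact hn
  have hE : 16 < log2 (1 / ε) := by
    unfold log2
    rw [one_div, Real.logb_inv, lt_neg, Real.logb_lt_iff_lt_rpow (by norm_num) hε]
    exact hε2
  have hLe : (2 : ℝ) ^ (log2 n) = n := Real.rpow_logb (by norm_num) (by norm_num) hn0
  have hEe : (2 : ℝ) ^ (log2 (1 / ε)) = 1 / ε :=
    Real.rpow_logb (by norm_num) (by norm_num) (by positivity)
  set L := log2 n
  set E := log2 (1 / ε)
  have hε1 : ε ≤ 1 := by
    refine hε2.le.trans ?_
    exact Real.rpow_le_one_of_one_le_of_nonpos (by norm_num) (by norm_num)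
  have hεE : ε ^ 2 * (2 : ℝ) ^ (2 * E) = 1 := by
    rw [mul_comm 2 E, Real.rpow_mul (by norm_num), hEe]
    norm_num
    field_simp
  let d := ⌈6 + L + 2 * E⌉₊
  let m := k / 8
  have hd1 : 6 + L + 2 * E ≤ d := Nat.le_ceil _
  have hd2 : (d : ℝ) < 6 + L + 2 * E + 1 := Nat.ceil_lt_add_one (by linarith)
  have hm1 : 8 * m ≤ k := Nat.mul_div_le k 8
  have hm2 : k < 8 * m + 8 := by omega
  have hm2r : (k : ℝ) + 1 ≤ 8 * m + 8 := by exact_mod_cast hm2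
  have hmE : E ≤ m := by linarith
  have hdk : d ≤ k := by
    have : (d : ℝ) ≤ k := by linarith
    exact_mod_cast this
  have hm16 : 16 ≤ m := by
    have : (16 : ℝ) ≤ m := by linarith
    exact_mod_cast this
  have c1 : 64 * (n : ℝ) ≤ ε ^ 2 * 2 ^ d := by
    have : (2 : ℝ) ^ (6 + L + 2 * E) ≤ 2 ^ d := by
      rw [← Real.rpow_natCast]
      exact Real.rpow_le_rpow_of_exponent_le (by norm_num) hd1
    rw [Real.rpow_add (by norm_num), Real.rpow_add (by norm_num), hLe] at this
    have h64 : (2 : ℝ) ^ (6 : ℝ) = 64 := by norm_num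
    rw [h64] at this
    calc 64 * (n : ℝ) = ε ^ 2 * (64 * n * (2 : ℝ) ^ (2 * E)) := by
          linear_combination (-64 * (n : ℝ)) * hεE
      _ ≤ _ := by gcongr
  have c2 : 32 * ((d : ℝ) + 4 ^ m + 1) < ε ^ 2 * 2 ^ k := by
    have a1 : (2 : ℝ) ^ (2 * E) ≤ 4 ^ m := by
      have : (2 : ℝ) ^ (2 * E) ≤ (2 : ℝ) ^ ((2 * m : ℕ) : ℝ) := by
        apply Real.rpow_le_rpow_of_exponent_le (by norm_num)
        push_cast
        linarith
      rw [Real.rpow_natCast, pow_mul] at this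
      norm_num at this
      exact this
    have a2 : (1 : ℝ) ≤ ε ^ 2 * 4 ^ m := by
      rw [← hεE]; gcongr
    have a3 : (256 : ℝ) ^ m ≤ 2 ^ k := by
      calc (256 : ℝ) ^ m = 2 ^ (8 * m) := by rw [pow_mul]; norm_num
        _ ≤ 2 ^ k := pow_le_pow_right₀ (by norm_num) hm1
    have a4 : (64 : ℝ) ^ m ≤ ε ^ 2 * 2 ^ k := by
      calc (64 : ℝ) ^ m ≤ (ε ^ 2 * 4 ^ m) * 64 ^ m := le_mul_of_one_le_left (by positivity) a2
        _ = ε ^ 2 * 256 ^ m := by rw [mul_assoc, ← mul_pow]; norm_num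
        _ ≤ _ := by gcongr
    have a5 : (m : ℝ) + 1 ≤ 4 ^ m := by
      have : m < 4 ^ m := Nat.lt_pow_self (by norm_num)
      exact_mod_cast this
    have a6 : (d : ℝ) + 1 ≤ 8 * 4 ^ m := by
      have : (d : ℝ) ≤ k := by exact_mod_cast hdk
      linarith
    have a7 : (288 : ℝ) < 16 ^ m := by
      calc (288 : ℝ) < 16 ^ 16 := by norm_num
        _ ≤ 16 ^ m := pow_le_pow_right₀ (by norm_num) hm16
    have a8 : (288 : ℝ) * 4 ^ m < 64 ^ m := by
      calc (288 : ℝ) * 4 ^ m < 16 ^ m * 4 ^ m := by gcongr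
        _ = 64 ^ m := by rw [← mul_pow]; norm_num
    linarith
  obtain ⟨ext, hext⟩ := exists_ext n k d m ε hε hε1 c1 c2
  exact ⟨d, m, ext, by linarith, by linarith, hext⟩

lemma pow_factor (a : ℕ) (ha : 2 ≤ a) (ε : ℝ) (hε : 0 < ε) (hε2 : ε < (2 : ℝ) ^ (-(16 : ℝ)))
    (c : ℝ) (hc : 2 ≤ c) :
    16 < log2 (1 / ε) ∧ c + 1 ≤ (2 : ℝ) ^ (c * a * (log2 (log2 (1 / ε))) ^ ((1 : ℝ) / a)) := by
  have hE : 16 < log2 (1 / ε) := by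
    unfold log2
    rw [one_div, Real.logb_inv, lt_neg, Real.logb_lt_iff_lt_rpow (by norm_num) hε]
    exact hε2
  refine ⟨hE, ?_⟩
  have h1 : 1 ≤ log2 (log2 (1 / ε)) := by
    rw [show log2 (log2 (1 / ε)) = Real.logb 2 (log2 (1 / ε)) from rfl,
      Real.le_logb_iff_rpow_le (by norm_num) (by linarith)]
    norm_num at hE ⊢
    linarith
  have h2 : 1 ≤ (log2 (log2 (1 / ε))) ^ ((1 : ℝ) / a) := Real.one_le_rpow h1 (by positivity)
  have ha' : (2 : ℝ) ≤ a := by exact_mod_cast ha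
  have h3 : c ≤ c * a * (log2 (log2 (1 / ε))) ^ ((1 : ℝ) / a) := by
    have : 1 ≤ (a : ℝ) * (log2 (log2 (1 / ε))) ^ ((1 : ℝ) / a) := by nlinarith
    rw [mul_assoc]
    exact le_mul_of_one_le_right (by linarith) this
  have h4 : c + 1 ≤ (2 : ℝ) ^ c := by
    have := one_add_mul_self_le_rpow_one_add (s := 1) (by norm_num) (p := c) (by linarith)
    norm_num at this
    linarith
  exact h4.trans (Real.rpow_le_rpow_of_exponent_le (by norm_num) h3)

theorem stmt8 :
    ∃ C c1 α : ℝ, 1 < C ∧ 0 < c1 ∧ 0 < α ∧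
      (∀ a : ℕ, 2 ≤ a → ∀ n k : ℕ, 16 ≤ n → ∀ ε : ℝ,
        0 < ε → ε < (2 : ℝ) ^ (-(16 : ℝ)) →
        C * (log2 n + a * log2 (1 / ε)) ≤ (k : ℝ) →
        ∃ (d m : ℕ) (ext : BS n → BS d → BS m),
          (d : ℝ) ≤ c1 * log2 n +
              log2 (1 / ε) * (2 : ℝ) ^ (c1 * a * (log2 (log2 (1 / ε))) ^ ((1 : ℝ) / a)) ∧
          α * k ≤ (m : ℝ) ∧
          IsStrongSNME ext (k : ℝ) ε) ∧
      (∀ a : ℕ, 2 ≤ a → ∀ n k : ℕ, 16 ≤ n → ∀ ε : ℝ,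
        0 < ε → ε < (2 : ℝ) ^ (-(16 : ℝ)) →
        C * log2 n +
            log2 (1 / ε) * (2 : ℝ) ^ (C * a * (log2 (log2 (1 / ε))) ^ ((1 : ℝ) / a)) ≤ (k : ℝ) →
        ∃ (d m : ℕ) (ext : BS n → BS d → BS m),
          (d : ℝ) ≤ c1 * (log2 n + a * log2 (1 / ε)) ∧
          α * k ≤ (m : ℝ) ∧
          IsStrongSNME ext (k : ℝ) ε) := by

  refine ⟨8, 3, 1 / 16, by norm_num, by norm_num, by norm_num, ?_, ?_⟩
  · intro a ha n k hn ε hε hε2 hk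
    obtain ⟨hE, hp⟩ := pow_factor a ha ε hε hε2 3 (by norm_num)
    have ha' : (2 : ℝ) ≤ a := by exact_mod_cast ha
    obtain ⟨d, m, ext, h1, h2, h3⟩ := main_exists n k hn ε hε hε2 (by nlinarith)
    exact ⟨d, m, ext, by nlinarith, h2, h3⟩
  · intro a ha n k hn ε hε hε2 hk
    obtain ⟨hE, hp⟩ := pow_factor a ha ε hε hε2 8 (by norm_num)
    have ha' : (2 : ℝ) ≤ a := by exact_mod_cast ha
    obtain ⟨d, m, ext, h1, h2, h3⟩ := main_exists n k hn ε hε hε2 (by nlinarith)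
    exact ⟨d, m, ext, by nlinarith, h2, h3⟩
end
end

section
/- There exist constants 0 < α, β < 1 and an integer n0 such that for every n ≥ n0, setting m = ⌈n/β⌉, there exists an n × m matrix M over F_2 such that: (i) every nonzero F_2-linear combination of the rows of M has Hamming weight at least m/4 (so M is the generating matrix of a binary linear code of rate at least β and relative minimum distance at least 1/4); and (ii) for every set S of ⌊αn⌋ column indices, the submatrix of M consisting of the columns in S and the last ⌈n/2⌉ rows has full column rank over F_2. -/
noncomputable section

/-- Hamming weight. -/
def hwt {m : ℕ} (u : Fin m → ZMod 2) : ℕ := (Finset.univ.filter (fun j => u j ≠ 0)).card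

lemma sum_wt (m : ℕ) (x : ℝ) : ∑ u : Fin m → ZMod 2, x ^ (hwt u) = (1 + x) ^ m := by
  have h1 : ∀ u : Fin m → ZMod 2, x ^ (hwt u) = ∏ j, (if u j ≠ 0 then x else 1) := by
    intro u
    rw [hwt, Finset.prod_ite]
    simp
  simp_rw [h1]
  have h2 := Finset.prod_univ_sum (fun _ : Fin m => (Finset.univ : Finset (ZMod 2)))
    (fun _ a => if a ≠ 0 then x else (1 : ℝ))
  rw [Fintype.piFinset_univ] at h2
  rw [← h2]
  have h3 : ∑ a : ZMod 2, (if a ≠ 0 then x else (1 : ℝ)) = 1 + x := by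
    change ∑ a : Fin 2, (if a ≠ 0 then x else (1 : ℝ)) = 1 + x
    rw [Fin.sum_univ_two]
    simp
  rw [h3]
  simp

lemma ball_bound (m k : ℕ) (x : ℝ) (hx : 0 < x) (hx1 : x ≤ 1) :
    ((Finset.univ.filter (fun u : Fin m → ZMod 2 => hwt u ≤ k)).card : ℝ) * x ^ k
      ≤ (1 + x) ^ m := by
  rw [← sum_wt, ← nsmul_eq_mul, ← Finset.sum_const]
  calc _ ≤ ∑ u ∈ Finset.univ.filter (fun u : Fin m → ZMod 2 => hwt u ≤ k), x ^ hwt u := by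
        apply Finset.sum_le_sum
        intro u hu
        exact pow_le_pow_of_le_one hx.le hx1 (Finset.mem_filter.1 hu).2
    _ ≤ _ := by
        apply Finset.sum_le_sum_of_subset_of_nonneg (Finset.subset_univ _)
        intros
        positivity

lemma card_fiber {G H : Type*} [AddGroup G] [AddGroup H] [Fintype G] [Fintype H]
    [DecidableEq H] (f : G →+ H) (hf : Function.Surjective f) (h : H) :
    (Finset.univ.filter (fun g => f g = h)).card * Fintype.card H = Fintype.card G := by
  have h1 := Finset.card_eq_sum_card_fiberwise (f := f) (s := Finset.univ) (t := Finset.univ)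
    (by simp)
  rw [← Finset.card_univ (α := G), h1, Finset.sum_congr rfl (fun b _ =>
    AddMonoidHom.card_fiber_eq_of_mem_range f (hf b) (hf h))]
  simp [mul_comm]

lemma fiber1 {n m : ℕ} (v : Fin n → ZMod 2) (hv : v ≠ 0) (w : Fin m → ZMod 2) :
    (Finset.univ.filter (fun M : Matrix (Fin n) (Fin m) (ZMod 2) =>
      Matrix.vecMul v M = w)).card * 2 ^ m
      = Fintype.card (Matrix (Fin n) (Fin m) (ZMod 2)) := by
  obtain ⟨i, hi⟩ := Function.ne_iff.1 hv
  simp only [Pi.zero_apply] at hi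
  have := card_fiber (G := Matrix (Fin n) (Fin m) (ZMod 2)) (H := Fin m → ZMod 2)
    ⟨⟨fun M => Matrix.vecMul v M, by simp⟩, fun A B => by simp [Matrix.vecMul_add]⟩ (by
      intro w
      refine ⟨fun a b => if a = i then (v i)⁻¹ * w b else 0, ?_⟩
      funext b
      simp [Matrix.vecMul, dotProduct, hi]) w
  simpa [ZMod.card] using this

lemma fiber2 {n m : ℕ} (p : Fin n → Prop) [DecidablePred p] (u : Fin m → ZMod 2) (hu : u ≠ 0) :
    (Finset.univ.filter (fun M : Matrix (Fin n) (Fin m) (ZMod 2) =>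
      ∀ i : {i // p i}, Matrix.mulVec M u i.val = 0)).card * 2 ^ (Fintype.card {i // p i})
      = Fintype.card (Matrix (Fin n) (Fin m) (ZMod 2)) := by
  obtain ⟨i, hi⟩ := Function.ne_iff.1 hu
  simp only [Pi.zero_apply] at hi
  have := card_fiber (G := Matrix (Fin n) (Fin m) (ZMod 2)) (H := {i // p i} → ZMod 2)
    ⟨⟨fun M a => Matrix.mulVec M u a.val, by ext; simp⟩,
      fun A B => by ext; simp [Matrix.add_mulVec]⟩ (by
      intro w
      refine ⟨fun a b => if b = i then (if h : p a then (u i)⁻¹ * w ⟨a, h⟩ else 0) else 0, ?_⟩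
      funext b
      have := b.2
      simp [Matrix.mulVec, dotProduct, this]
      field_simp) 0
  simpa [ZMod.card, funext_iff] using this

lemma card_last (n : ℕ) :
    Fintype.card {i : Fin n // n - (n + 1) / 2 ≤ i.val} = (n + 1) / 2 := by
  rw [Fintype.card_subtype]
  have := Fin.card_filter_val_lt (n := n) (m := n - (n + 1) / 2)
  have h2 := Finset.card_filter_add_card_filter_not (s := (Finset.univ : Finset (Fin n)))
    (fun i : Fin n => i.val < n - (n+1)/2)
  simp only [not_lt, Finset.card_univ, Fintype.card_fin] at h2
  omega

lemma num1 (n : ℕ) (hn : 4 ≤ n) (V : ℝ) (h : V * (1/2 : ℝ) ^ (4 * n) ≤ (1 + 1/2) ^ (16 * n)) :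
    2 ^ n * V / 2 ^ (16 * n) < 1 / 2 := by
  have h1 : V ≤ ((3/2 : ℝ) ^ 16 * 2 ^ 4) ^ n := by
    rw [mul_pow, ← pow_mul, ← pow_mul]
    have : (0:ℝ) < 2 ^ (4 * n) := by positivity
    calc V = V * (1/2 : ℝ) ^ (4 * n) * 2 ^ (4 * n) := by
          rw [mul_assoc, ← mul_pow]; norm_num
      _ ≤ _ := by
          apply mul_le_mul_of_nonneg_right _ this.le
          rwa [show (1 + 1/2 : ℝ) = 3/2 by norm_num] at h
  calc 2 ^ n * V / 2 ^ (16 * n) ≤ 2 ^ n * ((3/2 : ℝ) ^ 16 * 2 ^ 4) ^ n / 2 ^ (16 * n) := by gcongr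
    _ = (2 * ((3/2 : ℝ) ^ 16 * 2 ^ 4) / 2 ^ 16) ^ n := by
        rw [pow_mul 2 16 n, ← mul_pow, ← div_pow]
    _ ≤ (1/3) ^ n := by
        apply pow_le_pow_left₀ (by positivity)
        norm_num
    _ ≤ (1/3) ^ 1 := pow_le_pow_of_le_one (by norm_num) (by norm_num) (by omega)
    _ < 1/2 := by norm_num

lemma num2 (n k : ℕ) (hn : 4 ≤ n) (hk : 64 * k ≤ n) (V : ℝ) (hV : 0 ≤ V)
    (h : V * (1/256 : ℝ) ^ k ≤ (1 + 1/256) ^ (16 * n)) :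
    V / 2 ^ ((n + 1) / 2) ≤ 1 / 2 := by
  have h1 : V ≤ (257/256 : ℝ) ^ (16 * n) * 2 ^ (8 * k) := by
    have : (0:ℝ) < 2 ^ (8 * k) := by positivity
    calc V = V * (1/256 : ℝ) ^ k * 2 ^ (8 * k) := by
          rw [mul_assoc, pow_mul, ← mul_pow]; norm_num
      _ ≤ _ := by
          apply mul_le_mul_of_nonneg_right _ this.le
          rwa [show (1 + 1/256 : ℝ) = 257/256 by norm_num] at h
  have h2 : V ^ 8 ≤ 2 ^ (2 * n) := by
    calc V ^ 8 ≤ ((257/256 : ℝ) ^ (16 * n) * 2 ^ (8 * k)) ^ 8 := pow_le_pow_left₀ hV h1 8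
      _ = ((257/256 : ℝ) ^ 128) ^ n * 2 ^ (64 * k) := by
          rw [mul_pow, ← pow_mul, ← pow_mul, ← pow_mul]
          congr 2 <;> ring
      _ ≤ 2 ^ n * 2 ^ n := by
          apply mul_le_mul
          · exact pow_le_pow_left₀ (by positivity) (by norm_num) n
          · exact pow_le_pow_right₀ (by norm_num) hk
          · positivity
          · positivity
      _ = _ := by rw [← pow_add]; congr 1; ring
  rw [div_le_iff₀ (by positivity)]
  refine le_of_pow_le_pow_left₀ (n := 8) (by norm_num) (by positivity) (h2.trans ?_)
  rw [mul_pow, ← pow_mul]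
  have : (2:ℝ) ^ (2 * n + 8) ≤ 2 ^ ((n+1)/2 * 8) := pow_le_pow_right₀ (by norm_num) (by omega)
  rw [pow_add] at this
  norm_num at this ⊢
  linarith

lemma core (n k : ℕ) (hn : 4 ≤ n) (hk : 64 * k ≤ n) :
    ∃ M : Matrix (Fin n) (Fin (16 * n)) (ZMod 2),
      (∀ v, v ≠ 0 → 4 * n < hwt (Matrix.vecMul v M)) ∧
      (∀ u, u ≠ 0 → hwt u ≤ k → ¬ ∀ i : {i : Fin n // n - (n + 1) / 2 ≤ i.val},
        Matrix.mulVec M u i.val = 0) := by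
  classical
  by_contra hcon
  push Not at hcon
  set W := Finset.univ.filter (fun u : Fin (16 * n) → ZMod 2 => hwt u ≤ 4 * n) with hW
  set U := Finset.univ.filter (fun u : Fin (16 * n) → ZMod 2 => hwt u ≤ k) with hU
  set N := Fintype.card (Matrix (Fin n) (Fin (16 * n)) (ZMod 2)) with hN
  have hN0 : (0:ℝ) < N := by
    have : 0 < N := Fintype.card_pos
    exact_mod_cast this
  let B1 : Finset (Matrix (Fin n) (Fin (16 * n)) (ZMod 2)) :=
    ((Finset.univ.filter (fun v : Fin n → ZMod 2 => v ≠ 0)) ×ˢ W).biUnion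
      (fun p => Finset.univ.filter (fun M => Matrix.vecMul p.1 M = p.2))
  let B2 : Finset (Matrix (Fin n) (Fin (16 * n)) (ZMod 2)) :=
    (U.filter (fun u => u ≠ 0)).biUnion
      (fun u => Finset.univ.filter (fun M => ∀ i : {i : Fin n // n - (n + 1) / 2 ≤ i.val},
        Matrix.mulVec M u i.val = 0))
  have hcov : Finset.univ ⊆ B1 ∪ B2 := by
    intro M _
    rw [Finset.mem_union]
    by_cases h : ∀ v, v ≠ 0 → 4 * n < hwt (Matrix.vecMul v M)
    · right
      obtain ⟨u, hu, hu2, hu3⟩ := hcon M h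
      simp only [B2, Finset.mem_biUnion, Finset.mem_filter, hU, Finset.mem_univ, true_and]
      exact ⟨u, ⟨hu2, hu⟩, hu3⟩
    · left
      push Not at h
      obtain ⟨v, hv, hv2⟩ := h
      simp only [B1, Finset.mem_biUnion, Finset.mem_filter, hW, Finset.mem_univ, true_and,
        Finset.mem_product]
      exact ⟨(v, Matrix.vecMul v M), ⟨hv, hv2⟩, rfl⟩
  have hcard : (N : ℝ) ≤ B1.card + B2.card := by
    have h1 := (Finset.card_le_card hcov).trans (Finset.card_union_le _ _)
    rw [Finset.card_univ] at h1
    exact_mod_cast h1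
  have hB1 : (B1.card : ℝ) ≤ 2 ^ n * W.card / 2 ^ (16 * n) * N := by
    have h0 : (B1.card : ℝ) ≤ ∑ p ∈ (Finset.univ.filter (fun v : Fin n → ZMod 2 => v ≠ 0)) ×ˢ W,
        (N : ℝ) / 2 ^ (16 * n) := by
      have := Finset.card_biUnion_le
        (s := (Finset.univ.filter (fun v : Fin n → ZMod 2 => v ≠ 0)) ×ˢ W)
        (t := fun p => Finset.univ.filter
          (fun M : Matrix (Fin n) (Fin (16 * n)) (ZMod 2) => Matrix.vecMul p.1 M = p.2))
      have h' : (B1.card : ℝ) ≤ _ := Nat.cast_le.2 this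
      rw [Nat.cast_sum] at h'
      refine h'.trans (Finset.sum_le_sum fun p hp => ?_)
      rw [le_div_iff₀ (by positivity)]
      have := fiber1 p.1 (by simpa using (Finset.mem_product.1 hp).1) p.2
      rw [hN, ← this]
      push_cast
      exact le_rfl
    refine h0.trans ?_
    rw [Finset.sum_const, nsmul_eq_mul, Finset.card_product]
    have hv : ((Finset.univ.filter (fun v : Fin n → ZMod 2 => v ≠ 0)).card : ℝ) ≤ 2 ^ n := by
      have := Finset.card_filter_le (Finset.univ) (fun v : Fin n → ZMod 2 => v ≠ 0)
      simp only [Finset.card_univ, Fintype.card_fun, ZMod.card, Fintype.card_fin] at this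
      exact_mod_cast this
    push_cast
    calc _ ≤ (2 ^ n * (W.card : ℝ)) * (N / 2 ^ (16 * n)) := by gcongr
      _ = _ := by ring
  have hB2 : (B2.card : ℝ) ≤ U.card / 2 ^ ((n + 1) / 2) * N := by
    have h0 : (B2.card : ℝ) ≤ ∑ p ∈ U.filter (fun u => u ≠ 0),
        (N : ℝ) / 2 ^ ((n + 1) / 2) := by
      have := Finset.card_biUnion_le
        (s := U.filter (fun u => u ≠ 0))
        (t := fun u => Finset.univ.filter (fun M : Matrix (Fin n) (Fin (16 * n)) (ZMod 2) =>
          ∀ i : {i : Fin n // n - (n + 1) / 2 ≤ i.val}, Matrix.mulVec M u i.val = 0))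
      have h' : (B2.card : ℝ) ≤ _ := Nat.cast_le.2 this
      rw [Nat.cast_sum] at h'
      refine h'.trans (Finset.sum_le_sum fun u hu => ?_)
      rw [le_div_iff₀ (by positivity)]
      have := fiber2 (fun i : Fin n => n - (n + 1) / 2 ≤ i.val) u (Finset.mem_filter.1 hu).2
      rw [card_last] at this
      rw [hN, ← this]
      push_cast
      exact le_of_eq (by congr!)
    refine h0.trans ?_
    rw [Finset.sum_const, nsmul_eq_mul]
    have hv : ((U.filter (fun u => u ≠ 0)).card : ℝ) ≤ U.card :=
      Nat.cast_le.2 (Finset.card_filter_le _ _)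
    calc _ ≤ (U.card : ℝ) * (N / 2 ^ ((n + 1) / 2)) := by gcongr
      _ = _ := by ring
  have e1 := num1 n hn W.card (ball_bound _ _ _ (by norm_num) (by norm_num))
  have e2 := num2 n k hn hk U.card (by positivity) (ball_bound _ _ _ (by norm_num) (by norm_num))
  have f1 := mul_lt_mul_of_pos_right e1 hN0
  have f2 := mul_le_mul_of_nonneg_right e2 hN0.le
  linarith

theorem stmt13 :
    ∃ (α β : ℝ) (n0 : ℕ), 0 < α ∧ α < 1 ∧ 0 < β ∧ β < 1 ∧
      ∀ n : ℕ, n0 ≤ n →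
        ∃ M : Matrix (Fin n) (Fin ⌈(n : ℝ) / β⌉₊) (ZMod 2),
          -- (i) every nonzero linear combination of the rows has Hamming weight ≥ m/4
          (∀ v : Fin n → ZMod 2, v ≠ 0 →
            ((⌈(n : ℝ) / β⌉₊ : ℝ)) / 4 ≤
              ((Finset.univ.filter (fun j => Matrix.vecMul v M j ≠ 0)).card : ℝ)) ∧
          -- (ii) any ⌊αn⌋ columns, restricted to the last ⌈n/2⌉ rows, are linearly
          -- independent (full column rank)
          (∀ S : Finset (Fin ⌈(n : ℝ) / β⌉₊), S.card = ⌊α * n⌋₊ →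
            LinearIndependent (ZMod 2)
              (fun j : {j // j ∈ S} =>
                fun i : {i : Fin n // n - (n + 1) / 2 ≤ i.val} => M i.val j.val)) := by
  refine ⟨1/64, 1/16, 4, by norm_num, by norm_num, by norm_num, by norm_num, ?_⟩
  intro n hn
  have hm : ⌈(n : ℝ) / (1/16)⌉₊ = 16 * n := by
    rw [show (n : ℝ) / (1/16) = ((16 * n : ℕ) : ℝ) by push_cast; ring, Nat.ceil_natCast]
  have hk : 64 * ⌊(1/64 : ℝ) * n⌋₊ ≤ n := by
    have := Nat.floor_le (a := (1/64 : ℝ) * n) (by positivity)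
    have h2 : (64 : ℝ) * (⌊(1/64 : ℝ) * n⌋₊ : ℝ) ≤ n := by linarith
    exact_mod_cast h2
  rw [hm]
  generalize ⌊(1/64 : ℝ) * n⌋₊ = k at hk
  obtain ⟨M, h1, h2⟩ := core n k hn hk
  refine ⟨M, ?_, ?_⟩
  · intro v hv
    have h3 := h1 v hv
    have h4 : (4 * n : ℝ) < hwt (Matrix.vecMul v M) := by exact_mod_cast h3
    unfold hwt at h4
    push_cast
    linarith
  · intro S hS
    classical
    rw [Fintype.linearIndependent_iff]
    intro g hg
    by_contra hne
    push Not at hne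
    obtain ⟨j0, hj0⟩ := hne
    let u : Fin (16 * n) → ZMod 2 := fun j => if h : j ∈ S then g ⟨j, h⟩ else 0
    refine h2 u ?_ ?_ ?_
    · intro h
      apply hj0
      have := congrFun h j0.1
      simpa [u] using this
    · rw [← hS, hwt]
      apply Finset.card_le_card
      intro j hj
      by_contra hjS
      simp [u, hjS] at hj
    · intro i
      have h5 := congrFun hg i
      simp only [Finset.sum_apply, Pi.smul_apply, smul_eq_mul, Pi.zero_apply] at h5
      rw [← h5, Matrix.mulVec, dotProduct]
      rw [← Finset.sum_subset (Finset.subset_univ S), ← Finset.sum_coe_sort S]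
      · refine Finset.sum_congr rfl fun j _ => ?_
        simp [u, mul_comm]
      · intro j _ hj
        simp [u, hj]
end
end
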